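/- Let S ⊂ ℙ²(ℝ) with |S| = 9, and suppose there exists a psd sextic form vanishing at every point of S that is not a sum of squares. Then the space I₆(2S) of sextic forms singular at every point of S has dimension 2. -/

import Mathlib

open MvPolynomial

noncomputable section

/-- The real projective plane, as lines through the origin of `ℝ³`. -/
abbrev P2 := Projectivization ℝ (Fin 3 → ℝ)

/-- A polynomial is psd if it takes only nonnegative values on `ℝ³`. -/
def Psd (g : MvPolynomial (Fin 3) ℝ) : Prop := ∀ u : Fin 3 → ℝ, 0 ≤ eval u g

/-- A polynomial is sos if it is a finite sum of squares. -/
def Sos (g : MvPolynomial (Fin 3) ℝ) : Prop :=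
  ∃ (n : ℕ) (h : Fin n → MvPolynomial (Fin 3) ℝ), g = ∑ i, (h i) ^ 2

/-- A form vanishes at a point of `ℙ²(ℝ)` if it vanishes at a representative vector. -/
def VanishAt (g : MvPolynomial (Fin 3) ℝ) (P : P2) : Prop := eval P.rep g = 0

/-- A form is singular at a point of `ℙ²(ℝ)` if it and all its first partial
derivatives vanish at a representative vector. -/
def SingAt (g : MvPolynomial (Fin 3) ℝ) (P : P2) : Prop :=
  eval P.rep g = 0 ∧ ∀ i, eval P.rep (pderiv i g) = 0

/-- `I_d(T)`: the space of degree-`d` forms vanishing at every point of `T`. -/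
def Isub (d : ℕ) (T : Set P2) : Submodule ℝ (MvPolynomial (Fin 3) ℝ) :=
  (homogeneousSubmodule (Fin 3) ℝ d) ⊓
  { carrier := {f | ∀ P ∈ T, VanishAt f P}
    zero_mem' := by intro P _; simp [VanishAt]
    add_mem' := by
      intro a b ha hb P hP
      have h1 := ha P hP; have h2 := hb P hP
      unfold VanishAt at *; simp [h1, h2]
    smul_mem' := by
      intro c f hf P hP
      have h1 := hf P hP
      unfold VanishAt at *; simp [smul_eq_C_mul, h1] }

/-- `I_d(2T)`: the space of degree-`d` forms singular at every point of `T`. -/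
def Isub2 (d : ℕ) (T : Set P2) : Submodule ℝ (MvPolynomial (Fin 3) ℝ) :=
  (homogeneousSubmodule (Fin 3) ℝ d) ⊓
  { carrier := {f | ∀ P ∈ T, SingAt f P}
    zero_mem' := by intro P _; constructor <;> simp [SingAt]
    add_mem' := by
      intro a b ha hb P hP
      obtain ⟨h1, h2⟩ := ha P hP; obtain ⟨h3, h4⟩ := hb P hP
      exact ⟨by simp [h1, h3], fun i => by simp [h2 i, h4 i]⟩
    smul_mem' := by
      intro c f hf P hP
      obtain ⟨h1, h2⟩ := hf P hP
      refine ⟨by simp [smul_eq_C_mul, h1], fun i => ?_⟩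
      have := h2 i
      simp [smul_eq_C_mul, this] }

/-- `I₃(T)²`: the span of products of two cubics vanishing on `T`. -/
def IsqCubic (T : Set P2) : Submodule ℝ (MvPolynomial (Fin 3) ℝ) :=
  Submodule.span ℝ {h | ∃ f₁ ∈ Isub 3 T, ∃ f₂ ∈ Isub 3 T, h = f₁ * f₂}

/-- No 4 points of `T` on a line, no 7 on a conic. -/
def GenPos (T : Set P2) : Prop :=
  (∀ l : MvPolynomial (Fin 3) ℝ, l ≠ 0 → l.IsHomogeneous 1 →
    {P ∈ T | VanishAt l P}.encard ≤ 3) ∧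
  (∀ c : MvPolynomial (Fin 3) ℝ, c ≠ 0 → c.IsHomogeneous 2 →
    {P ∈ T | VanishAt c P}.encard ≤ 6)

/-- The real projective zero set of `g`. -/
def VR (g : MvPolynomial (Fin 3) ℝ) : Set P2 := {P | VanishAt g P}

abbrev Pol := MvPolynomial (Fin 3) ℝ

lemma eval_smul_hom {F : Pol} {n : ℕ} (hF : F.IsHomogeneous n) (t : ℝ) (u : Fin 3 → ℝ) :
    eval (t • u) F = t ^ n * eval u F := by
  rw [eval_eq', eval_eq', Finset.mul_sum]
  refine Finset.sum_congr rfl fun d hd => ?_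
  have h1 : ∑ i, d i = n := by
    have := hF (mem_support_iff.1 hd)
    simpa [Finsupp.weight_apply, Finsupp.sum_fintype] using this
  simp only [Pi.smul_apply, smul_eq_mul, mul_pow, Finset.prod_mul_distrib]
  rw [Finset.prod_pow_eq_pow_sum, h1]; ring

/-- auxiliary grading homomorphism -/
def gradHom : Pol →ₐ[ℝ] Polynomial Pol :=
  aeval (fun i => Polynomial.C (X i) * Polynomial.X)

lemma gradHom_monomial (d : Fin 3 →₀ ℕ) (r : ℝ) :
    gradHom (monomial d r) = Polynomial.monomial d.degree (monomial d r) := by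
  unfold gradHom
  rw [aeval_monomial, Finsupp.prod_fintype _ _ (by simp)]
  simp only [mul_pow, Finset.prod_mul_distrib]
  rw [Finset.prod_pow_eq_pow_sum, monomial_eq (s := d), Finsupp.prod_fintype _ _ (by simp),
    Finsupp.degree_eq_sum, ← Polynomial.C_mul_X_pow_eq_monomial]
  simp only [map_mul, map_prod, map_pow, ← mul_assoc]
  rfl

lemma gradHom_coeff (p : Pol) (j : ℕ) :
    (gradHom p).coeff j = homogeneousComponent j p := by
  induction p using MvPolynomial.induction_on' with
  | monomial d r =>
    rw [gradHom_monomial, Polynomial.coeff_monomial]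
    ext e
    rw [coeff_homogeneousComponent]
    split_ifs with h1 h2 h2
    · rfl
    · rw [coeff_monomial, if_neg]; rintro rfl; exact h2 h1
    · rw [coeff_monomial, if_neg, coeff_zero]; rintro rfl; exact h1 h2
    · simp
  | add p q hp hq => simp [hp, hq]

lemma gradHom_inj {p : Pol} (h : gradHom p = 0) : p = 0 := by
  rw [← sum_homogeneousComponent p]
  exact Finset.sum_eq_zero fun i _ => by rw [← gradHom_coeff, h]; simp

lemma hom_of_gradHom {p : Pol} {a : ℕ} (h : ∀ j, j ≠ a → (gradHom p).coeff j = 0) :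
    p.IsHomogeneous a := by
  rw [← sum_homogeneousComponent p]
  refine IsHomogeneous.sum _ _ _ fun i _ => ?_
  by_cases hi : i = a
  · rw [hi]; exact homogeneousComponent_isHomogeneous _ _
  · rw [← gradHom_coeff, h i hi]; exact isHomogeneous_zero _ _ _

lemma hom_factor {A B : Pol} {n : ℕ} (h : (A * B).IsHomogeneous n) (h0 : A * B ≠ 0) :
    ∃ a b, A.IsHomogeneous a ∧ B.IsHomogeneous b ∧ a + b = n := by
  have hA0 : gradHom A ≠ 0 := fun h => h0 (by rw [gradHom_inj h, zero_mul])
  have hB0 : gradHom B ≠ 0 := fun h => h0 (by rw [gradHom_inj h, mul_zero])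
  have hAB : gradHom A * gradHom B = Polynomial.monomial n (A * B) := by
    rw [← map_mul]; ext1 j
    rw [gradHom_coeff, homogeneousComponent_of_mem h, Polynomial.coeff_monomial]
    simp only [eq_comm]
  have h1 := Polynomial.natDegree_mul hA0 hB0
  have h2 := Polynomial.natTrailingDegree_mul hA0 hB0
  rw [hAB, Polynomial.natDegree_monomial, if_neg h0] at h1
  rw [hAB, Polynomial.natTrailingDegree_monomial h0] at h2
  have h3 := Polynomial.natTrailingDegree_le_natDegree (gradHom A)
  have h4 := Polynomial.natTrailingDegree_le_natDegree (gradHom B)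
  refine ⟨(gradHom A).natDegree, (gradHom B).natDegree, hom_of_gradHom fun j hj => ?_,
    hom_of_gradHom fun j hj => ?_, h1.symm⟩
  · rcases lt_or_gt_of_ne hj with hj | hj
    · exact Polynomial.coeff_eq_zero_of_lt_natTrailingDegree (by omega)
    · exact Polynomial.coeff_eq_zero_of_natDegree_lt hj
  · rcases lt_or_gt_of_ne hj with hj | hj
    · exact Polynomial.coeff_eq_zero_of_lt_natTrailingDegree (by omega)
    · exact Polynomial.coeff_eq_zero_of_natDegree_lt hj

abbrev Hm (d : ℕ) := homogeneousSubmodule (Fin 3) ℝ d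

instance (d : ℕ) : FiniteDimensional ℝ (Hm d) :=
  Module.Finite.iff_fg.2 (homogeneousSubmodule_fg _ _ d)

lemma finrank_Hm (d : ℕ) : Module.finrank ℝ (Hm d) = (d + 2).choose 2 := by
  have e : Hm d = restrictSupport ℝ {m : Fin 3 →₀ ℕ | m.degree = d} := by
    unfold Hm
    rw [homogeneousSubmodule_eq_finsupp_supported]; rfl
  rw [e, Module.finrank_eq_nat_card_basis (basisRestrictSupport ℝ _)]
  have : {m : Fin 3 →₀ ℕ | m.degree = d} = ((Finset.univ : Finset (Fin 3)).finsuppAntidiag d : Set _) := by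
    ext m
    simp [Finsupp.degree_eq_sum, Finset.mem_finsuppAntidiag]
  rw [this, Nat.card_eq_fintype_card]
  simp [Finset.card_finsuppAntidiag_nat_eq_choose]
  rw [add_comm 2 d, Nat.choose_symm_add]

lemma cont_eval (F : Pol) : Continuous fun u : Fin 3 → ℝ => eval u F := MvPolynomial.continuous_eval F

lemma dense_ne {F : Pol} (hF : F ≠ 0) : Dense {u : Fin 3 → ℝ | eval u F ≠ 0} := by
  intro u
  by_contra hu
  apply hF
  apply MvPolynomial.funext
  intro x
  have h1 : ∀ᶠ v in nhds u, eval v F = 0 := by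
    rw [mem_closure_iff_frequently, Filter.not_frequently] at hu
    filter_upwards [hu] with v hv
    simpa using hv
  have := (AnalyticOnNhd.eval_mvPolynomial (𝕜 := ℝ) F).eqOn_zero_of_preconnected_of_eventuallyEq_zero
    isPreconnected_univ (Set.mem_univ u) h1 (Set.mem_univ x)
  simpa using this

lemma psd_of_sq_mul {c m : Pol} (hc : c ≠ 0) (h : Psd (c ^ 2 * m)) : Psd m := by
  have hcl : IsClosed {u : Fin 3 → ℝ | 0 ≤ eval u m} := isClosed_le continuous_const (cont_eval m)
  have hs : {u : Fin 3 → ℝ | eval u c ≠ 0} ⊆ {u | 0 ≤ eval u m} := by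
    intro u hu
    have := h u
    simp only [map_mul, map_pow] at this
    have hu0 : eval u c ≠ 0 := hu
    exact nonneg_of_mul_nonneg_right this (by positivity)
  intro u
  exact (hcl.closure_subset_iff.2 hs) (dense_ne hc u)

/-- directional derivative -/
lemma hasDeriv_line (F : Pol) (u v : Fin 3 → ℝ) :
    HasDerivAt (fun t : ℝ => eval (u + t • v) F) (∑ i, v i * eval u (pderiv i F)) 0 := by
  induction F using MvPolynomial.induction_on with
  | C a => simpa using hasDerivAt_const (0:ℝ) a
  | add p q hp hq =>
    have := hp.add hq
    simp only [map_add, mul_add, Finset.sum_add_distrib]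
    exact this
  | mul_X p j hp =>
    have h2 : HasDerivAt (fun t : ℝ => u j + t * v j) (v j) 0 := by
      simpa using ((hasDerivAt_id (0:ℝ)).mul_const (v j)).const_add (u j)
    have := hp.mul h2
    simp only [map_mul, eval_X, Pi.add_apply, Pi.smul_apply, smul_eq_mul]
    refine this.congr_deriv ?_
    simp [Derivation.leibniz, mul_add, Finset.sum_add_distrib, Finset.sum_mul]
    have : ∀ i, v i * (eval u p * eval u (Pi.single (M := fun _ => Pol) i 1 j : Pol)) = if i = j then v j * eval u p else 0 := by
      intro i; by_cases h : i = j
      · subst h; simp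
      · rw [Pi.single_eq_of_ne (Ne.symm h)]; simp [h]
    simp only [this]
    simp
    rw [add_comm, mul_comm (eval u p)]; congr 1
    exact Finset.sum_congr rfl fun i _ => by ring

lemma psd_sing {g : Pol} (hg : Psd g) {u : Fin 3 → ℝ} (h : eval u g = 0) (i : Fin 3) :
    eval u (pderiv i g) = 0 := by
  have h1 := hasDeriv_line g u (Pi.single i 1)
  have h2 : IsLocalMin (fun t : ℝ => eval (u + t • (Pi.single i 1 : Fin 3 → ℝ)) g) 0 := by
    refine Filter.Eventually.of_forall fun t => ?_
    simp only [zero_smul, add_zero, h]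
    exact hg _
  have := h2.hasDerivAt_eq_zero h1
  simpa [Pi.single_apply] using this

/-- gradient -/
def grad (F : Pol) (u : Fin 3 → ℝ) : Fin 3 → ℝ := fun i => eval u (pderiv i F)

lemma grad_add (F G : Pol) (u) : grad (F + G) u = grad F u + grad G u := by
  ext i; simp [grad]

lemma grad_smul (c : ℝ) (F : Pol) (u) : grad (c • F) u = c • grad F u := by
  ext i; simp [grad]

lemma grad_mul (F G : Pol) (u) :
    grad (F * G) u = eval u F • grad G u + eval u G • grad F u := by
  ext i; simp [grad, Derivation.leibniz]

lemma grad_euler {F : Pol} {n : ℕ} (hF : F.IsHomogeneous n) (u : Fin 3 → ℝ) :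
    u ⬝ᵥ grad F u = n * eval u F := by
  have := congrArg (eval u) hF.sum_X_mul_pderiv
  simpa [dotProduct, grad] using this

/-- linear form -/
def lin (a : Fin 3 → ℝ) : Pol := ∑ i, C (a i) * X i

lemma lin_hom (a) : (lin a).IsHomogeneous 1 :=
  IsHomogeneous.sum _ _ _ fun i _ => isHomogeneous_C_mul_X _ _

lemma eval_lin (a u) : eval u (lin a) = a ⬝ᵥ u := by simp [lin, dotProduct]

lemma grad_lin (a u) : grad (lin a) u = a := by
  ext i
  simp [grad, lin, Derivation.leibniz, Pi.single_apply]

lemma rep_ne_smul {P Q : P2} (h : P ≠ Q) (c : ℝ) : P.rep ≠ c • Q.rep := by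
  intro hc
  apply h
  rw [← P.mk_rep, ← Q.mk_rep, Projectivization.mk_eq_mk_iff']
  exact ⟨c, hc.symm⟩

lemma exists_sep {P Q : P2} (h : P ≠ Q) : ∃ a : Fin 3 → ℝ, a ⬝ᵥ Q.rep = 0 ∧ a ⬝ᵥ P.rep ≠ 0 := by
  set p := P.rep
  set q := Q.rep
  have hq : q ⬝ᵥ q ≠ 0 := by
    rw [Ne, dotProduct_self_eq_zero]; exact Q.rep_nonzero
  let a := (q ⬝ᵥ q) • p - (p ⬝ᵥ q) • q
  have h1 : a ⬝ᵥ q = 0 := by simp [a, sub_dotProduct]; ring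
  refine ⟨a, h1, fun h2 => ?_⟩
  have h3 : a ⬝ᵥ a = 0 := by
    conv_lhs => rw [show a ⬝ᵥ a = a ⬝ᵥ ((q ⬝ᵥ q) • p - (p ⬝ᵥ q) • q) from rfl]
    rw [dotProduct_sub, dotProduct_smul, dotProduct_smul, h1, h2]; simp
  rw [dotProduct_self_eq_zero] at h3
  apply rep_ne_smul h ((p ⬝ᵥ q) / (q ⬝ᵥ q))
  have h4 : (q ⬝ᵥ q) • p = (p ⬝ᵥ q) • q := sub_eq_zero.1 h3
  change p = _ • q
  rw [div_eq_inv_mul, mul_smul, ← h4, smul_smul, inv_mul_cancel₀ hq, one_smul]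

lemma exists_sepForm (T : Finset P2) (P : P2) (hP : P ∈ T) (d : ℕ) (hd : 2 * T.card ≤ d) :
    ∃ K : Pol, K.IsHomogeneous d ∧ eval P.rep K ≠ 0 ∧
      ∀ Q ∈ T, Q ≠ P → eval Q.rep K = 0 ∧ grad K Q.rep = 0 := by
  classical
  have h1 : ∀ Q : P2, ∃ a : Fin 3 → ℝ, a ⬝ᵥ P.rep ≠ 0 ∧ (Q ≠ P → a ⬝ᵥ Q.rep = 0) := by
    intro Q
    by_cases h : Q = P
    · refine ⟨P.rep, ?_, fun h' => absurd h h'⟩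
      rw [Ne, dotProduct_self_eq_zero]; exact P.rep_nonzero
    · obtain ⟨a, h1, h2⟩ := exists_sep (Ne.symm h)
      exact ⟨a, h2, fun _ => h1⟩
  choose a ha1 ha2 using h1
  refine ⟨(∏ Q ∈ T, lin (a Q) ^ 2) * lin (a P) ^ (d - 2 * T.card), ?_, ?_, ?_⟩
  · have e : d = (∑ Q ∈ T, 1 * 2) + 1 * (d - 2 * T.card) := by simp; omega
    have := (IsHomogeneous.prod T _ _ fun Q _ => (lin_hom (a Q)).pow 2).mul
      ((lin_hom (a P)).pow (d - 2 * T.card))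
    rwa [← e] at this
  · simp only [map_mul, map_prod, map_pow, eval_lin]
    exact mul_ne_zero (Finset.prod_ne_zero_iff.2 fun Q _ => pow_ne_zero _ (ha1 Q))
      (pow_ne_zero _ (ha1 P))
  · intro Q hQ hQP
    have h0 : eval Q.rep (lin (a Q)) = 0 := by rw [eval_lin]; exact ha2 Q hQP
    rw [← Finset.mul_prod_erase T _ hQ, pow_two, mul_assoc, mul_assoc]
    refine ⟨by simp [h0], ?_⟩
    rw [grad_mul, h0]
    simp [h0]

/-- all gradients -/
def gradT (T : Finset P2) (d : ℕ) : Hm d →ₗ[ℝ] (T → Fin 3 → ℝ) where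
  toFun F := fun P => grad F.1 P.1.rep
  map_add' F G := by ext1 P; exact grad_add _ _ _
  map_smul' c F := by ext1 P; exact grad_smul _ _ _

lemma gradT_surj (T : Finset P2) (d : ℕ) (hd : 2 * T.card ≤ d) :
    Function.Surjective (gradT T (d + 1)) := by
  classical
  intro w
  choose K hK1 hK2 hK3 using fun P : T => exists_sepForm T P.1 P.2 d hd
  have key : ∀ P : T, ∃ m : Fin 3 → ℝ, grad (K P * lin m) P.1.rep = w P := by
    intro P
    let L : (Fin 3 → ℝ) →ₗ[ℝ] (Fin 3 → ℝ) :=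
      { toFun := fun m => grad (K P * lin m) P.1.rep
        map_add' := by
          intro x y; simp only [grad_mul, grad_lin, eval_lin, add_dotProduct, add_smul, smul_add]
          abel
        map_smul' := by
          intro c x
          simp only [grad_mul, grad_lin, eval_lin, smul_dotProduct, RingHom.id_apply, smul_add,
            smul_smul, smul_eq_mul, mul_comm] }
    have hinj : Function.Injective L := by
      rw [← LinearMap.ker_eq_bot, LinearMap.ker_eq_bot']
      intro m hm
      have hm' : grad (K P * lin m) P.1.rep = 0 := hm
      have h1 := grad_euler ((hK1 P).mul (lin_hom m)) P.1.rep
      rw [hm', dotProduct_zero, map_mul, eval_lin] at h1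
      have h2 : m ⬝ᵥ P.1.rep = 0 := by
        rcases mul_eq_zero.1 h1.symm with h | h
        · norm_cast at h
        · exact (mul_eq_zero.1 h).resolve_left (hK2 P)
      rw [grad_mul, grad_lin, eval_lin, h2, zero_smul, add_zero] at hm'
      exact (smul_eq_zero.1 hm').resolve_left (hK2 P)
    exact LinearMap.injective_iff_surjective.1 hinj (w P)
  choose m hm using key
  refine ⟨∑ P : T, ⟨K P * lin (m P), (hK1 P).mul (lin_hom _)⟩, ?_⟩
  rw [map_sum]
  ext1 Q
  rw [Finset.sum_apply, Finset.sum_eq_single Q]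
  · exact hm Q
  · intro P _ hPQ
    have hne : Q.1 ≠ P.1 := fun h => hPQ (Subtype.ext h.symm)
    have := hK3 P Q.1 Q.2 hne
    change grad (K P * lin (m P)) Q.1.rep = 0
    rw [grad_mul, this.1, this.2]; simp
  · simp

lemma N_id (m n e : ℕ) : (m + n + e + 2).choose 2 + (e + 2).choose 2 =
    (n + e + 2).choose 2 + (m + e + 2).choose 2 + m * n := by
  have h : ∀ k : ℕ, ((k + 2).choose 2 : ℚ) = (k + 2) * (k + 1) / 2 := by
    intro k; rw [Nat.cast_choose_two]; push_cast; ring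
  have : (((m + n + e + 2).choose 2 + (e + 2).choose 2 : ℕ) : ℚ) =
    ((n + e + 2).choose 2 + (m + e + 2).choose 2 + m * n : ℕ) := by
    push_cast
    rw [h, h, h, h]; push_cast; ring
  exact_mod_cast this

theorem bezout {A B : Pol} {m n : ℕ} (hA : A.IsHomogeneous m) (hB : B.IsHomogeneous n)
    (hA0 : A ≠ 0) (hrel : IsRelPrime A B) (T : Finset P2)
    (hTA : ∀ P ∈ T, VanishAt A P) (hTB : ∀ P ∈ T, VanishAt B P) :
    3 * T.card ≤ m * n +
      ∑ P ∈ T, Module.finrank ℝ (Submodule.span ℝ {grad A P.rep, grad B P.rep}) := by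
  classical
  let e := 2 * T.card + 1
  let U : T → Submodule ℝ (Fin 3 → ℝ) := fun P => Submodule.span ℝ {grad A P.1.rep, grad B P.1.rep}
  let Ψ : (Hm (n + e) × Hm (m + e)) →ₗ[ℝ] Hm (m + n + e) :=
    { toFun := fun x => ⟨A * x.1.1 + B * x.2.1, by
        have h1 := hA.mul x.1.2
        have h2 := hB.mul x.2.2
        rw [show m + (n + e) = m + n + e by ring] at h1
        rw [show n + (m + e) = m + n + e by ring] at h2
        exact h1.add h2⟩
      map_add' := by intro x y; ext1; simp; ring
      map_smul' := by intro c x; ext1; simp }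
  have hker : Module.finrank ℝ (LinearMap.ker Ψ) ≤ Module.finrank ℝ (Hm e) := by
    let Θ : Hm e →ₗ[ℝ] (Hm (n + e) × Hm (m + e)) :=
      { toFun := fun E => (⟨-(B * E.1), (hB.mul E.2).neg⟩, ⟨A * E.1, hA.mul E.2⟩)
        map_add' := by intro x y; ext1 <;> ext1 <;> simp <;> ring
        map_smul' := by intro c x; ext1 <;> ext1 <;> simp }
    have hle : LinearMap.ker Ψ ≤ LinearMap.range Θ := by
      rintro ⟨⟨c, hc⟩, ⟨D, hD⟩⟩ hx
      have hx' : A * c + B * D = 0 := congrArg Subtype.val (LinearMap.mem_ker.1 hx)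
      have hdvd : A ∣ D := by
        refine hrel.dvd_of_dvd_mul_left ⟨-c, ?_⟩
        linear_combination hx'
      obtain ⟨E, rfl⟩ := hdvd
      have hE : E.IsHomogeneous e := by
        by_cases hE0 : E = 0
        · rw [hE0]; exact isHomogeneous_zero _ _ _
        · obtain ⟨a, b, ha, hb, hab⟩ := hom_factor hD (mul_ne_zero hA0 hE0)
          have := ha.inj_right hA hA0
          have : b = e := by omega
          rw [← this]; exact hb
      refine ⟨⟨E, hE⟩, ?_⟩
      have hcE : c = -(B * E) := by
        apply mul_left_cancel₀ hA0
        linear_combination hx'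
      ext1 <;> ext1
      · exact hcE.symm
      · rfl
    exact (Submodule.finrank_mono hle).trans (LinearMap.finrank_range_le Θ)
  have hrn := LinearMap.finrank_range_add_finrank_ker Ψ
  rw [Module.finrank_prod] at hrn
  let I := LinearMap.range Ψ
  have hmem : ∀ (x : I) (P : T), grad x.1.1 P.1.rep ∈ U P := by
    rintro ⟨x, ⟨c, D⟩, rfl⟩ P
    change grad (A * c.1 + B * D.1) P.1.rep ∈ U P
    have h1 : eval P.1.rep A = 0 := hTA _ P.2
    have h2 : eval P.1.rep B = 0 := hTB _ P.2
    rw [grad_add, grad_mul, grad_mul, h1, h2]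
    simp only [zero_smul, zero_add]
    exact Submodule.add_mem _ (Submodule.smul_mem _ _ (Submodule.subset_span (by simp)))
      (Submodule.smul_mem _ _ (Submodule.subset_span (by simp)))
  let Φ := gradT T (m + n + e)
  have hΦ : Function.Surjective Φ := gradT_surj T (m + n + 2 * T.card) (by omega)
  have hΦr := LinearMap.finrank_range_add_finrank_ker Φ
  rw [LinearMap.range_eq_top.2 hΦ, finrank_top] at hΦr
  let Φ' : I →ₗ[ℝ] (∀ P : T, U P) := LinearMap.pi fun P =>
    LinearMap.codRestrict (U P) ((LinearMap.proj P) ∘ₗ Φ ∘ₗ I.subtype) (fun x => hmem x P)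
  have hI := LinearMap.finrank_range_add_finrank_ker (K := ℝ) (V := I) (V₂ := ∀ P : T, U P) Φ'
  have hker' : Module.finrank ℝ (LinearMap.ker Φ') ≤ Module.finrank ℝ (LinearMap.ker Φ) := by
    let j : LinearMap.ker Φ' →ₗ[ℝ] LinearMap.ker Φ :=
      LinearMap.codRestrict _ (I.subtype ∘ₗ (LinearMap.ker Φ').subtype) (by
        rintro ⟨x, hx⟩
        rw [LinearMap.mem_ker] at hx ⊢
        ext1 P
        exact congrArg Subtype.val (congrFun hx P))
    refine LinearMap.finrank_le_finrank_of_injective (f := j) ?_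
    intro x y hxy
    have := congrArg Subtype.val hxy
    exact Subtype.ext (Subtype.ext this)
  have hr' : Module.finrank ℝ (LinearMap.range Φ') ≤ ∑ P : T, Module.finrank ℝ (U P) := by
    refine (Submodule.finrank_le _).trans ?_
    rw [Module.finrank_pi_fintype]
  have hs : ∑ P : T, Module.finrank ℝ (U P) =
      ∑ P ∈ T, Module.finrank ℝ (Submodule.span ℝ {grad A P.rep, grad B P.rep}) :=
    Finset.sum_coe_sort T (fun P => Module.finrank ℝ (Submodule.span ℝ {grad A P.rep, grad B P.rep}))
  have hdim : Module.finrank ℝ (T → Fin 3 → ℝ) = 3 * T.card := by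
    rw [Module.finrank_pi_fintype]; simp [mul_comm]
  have hN := N_id m n e
  rw [finrank_Hm, finrank_Hm] at hrn
  rw [finrank_Hm] at hker
  rw [hdim, finrank_Hm] at hΦr
  change _ + _ = Module.finrank ℝ (LinearMap.range Ψ) at hI
  omega

lemma finrank_span_one (a : Fin 3 → ℝ) : Module.finrank ℝ (Submodule.span ℝ {a, 0}) ≤ 1 := by
  rw [Set.pair_comm, Submodule.span_insert_zero]
  exact (finrank_span_le_card (R := ℝ) ({a} : Set (Fin 3 → ℝ))).trans (by simp)

lemma finrank_span_two' (a b : Fin 3 → ℝ) : Module.finrank ℝ (Submodule.span ℝ {a, b}) ≤ 2 := by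
  classical
  have h1 := finrank_span_le_card (R := ℝ) ({a, b} : Set (Fin 3 → ℝ))
  refine h1.trans ?_
  simpa using Finset.card_le_two (a := a) (b := b)

/-- simple Bezout -/
lemma bezout1 {A B : Pol} {m n : ℕ} (hA : A.IsHomogeneous m) (hB : B.IsHomogeneous n)
    (hA0 : A ≠ 0) (hrel : IsRelPrime A B) (T : Finset P2)
    (hTA : ∀ P ∈ T, VanishAt A P) (hTB : ∀ P ∈ T, VanishAt B P) : T.card ≤ m * n := by
  have h := bezout hA hB hA0 hrel T hTA hTB
  have h2 : ∑ P ∈ T, Module.finrank ℝ (Submodule.span ℝ {grad A P.rep, grad B P.rep})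
      ≤ T.card • 2 := Finset.sum_le_card_nsmul _ _ _ fun P _ => finrank_span_two' _ _
  rw [smul_eq_mul] at h2
  omega

/-- Bezout with B singular at the points of `T`, and extra common zeros `T'` -/
lemma bezout2 {A B : Pol} {m n : ℕ} (hA : A.IsHomogeneous m) (hB : B.IsHomogeneous n)
    (hA0 : A ≠ 0) (hrel : IsRelPrime A B) (T : Finset P2)
    (hTA : ∀ P ∈ T, VanishAt A P) (hTB : ∀ P ∈ T, SingAt B P) :
    2 * T.card ≤ m * n ∧
    (∀ P, P ∉ T → VanishAt A P → VanishAt B P → 2 * T.card + 1 ≤ m * n) ∧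
    (∀ P ∈ T, SingAt A P → 2 * T.card + 1 ≤ m * n) := by
  classical
  have h0 : ∀ P ∈ T, grad B P.rep = 0 := fun P hP => funext fun i => (hTB P hP).2 i
  have hle : ∀ P ∈ T, Module.finrank ℝ (Submodule.span ℝ {grad A P.rep, grad B P.rep}) ≤ 1 := by
    intro P hP
    rw [h0 P hP]; exact finrank_span_one _
  refine ⟨?_, ?_, ?_⟩
  · have h := bezout hA hB hA0 hrel T hTA (fun P hP => (hTB P hP).1)
    have h2 := Finset.sum_le_card_nsmul T _ 1 hle
    rw [smul_eq_mul] at h2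
    omega
  · intro P hP h1 h2
    have h := bezout hA hB hA0 hrel (insert P T)
      (by intro Q hQ; rcases Finset.mem_insert.1 hQ with rfl | hQ; exacts [h1, hTA Q hQ])
      (by intro Q hQ; rcases Finset.mem_insert.1 hQ with rfl | hQ; exacts [h2, (hTB Q hQ).1])
    have h2 := Finset.sum_le_card_nsmul T _ 1 hle
    have h3 := finrank_span_two' (grad A P.rep) (grad B P.rep)
    rw [Finset.sum_insert hP, Finset.card_insert_of_notMem hP] at h
    rw [smul_eq_mul] at h2
    omega
  · intro P hP h1
    have h := bezout hA hB hA0 hrel T hTA (fun P hP => (hTB P hP).1)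
    have h2 := Finset.sum_le_card_nsmul (T.erase P) _ 1
      (fun Q hQ => hle Q (Finset.mem_of_mem_erase hQ))
    rw [← Finset.add_sum_erase T _ hP] at h
    have h3 : grad A P.rep = 0 := funext fun i => h1.2 i
    rw [h3, h0 P hP] at h
    have h4 : Module.finrank ℝ (Submodule.span ℝ {(0 : Fin 3 → ℝ), 0}) = 0 := by simp
    rw [h4] at h
    rw [smul_eq_mul, Finset.card_erase_of_mem hP] at h2
    have := Finset.card_pos.2 ⟨P, hP⟩
    omega

lemma grid_zero {k : ℕ} {F : Pol} (hF : F.IsHomogeneous k)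
    (h : ∀ u ∈ Fintype.piFinset (fun _ : Fin 3 => (Finset.range (k + 1)).image (Nat.cast : ℕ → ℝ)),
      eval u F = 0) : F = 0 := by
  refine eq_zero_of_eval_zero_at_prod_finset F
    (fun _ => (Finset.range (k + 1)).image (Nat.cast : ℕ → ℝ)) ?_ ?_
  · intro i
    rw [Finset.card_image_of_injective _ Nat.cast_injective, Finset.card_range]
    have := F.degreeOf_le_totalDegree i
    have := hF.totalDegree_le
    omega
  · intro x hx
    exact h x (Fintype.mem_piFinset.2 hx)

open scoped MatrixOrder Matrix.Norms.L2Operator in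
lemma posSemidef_real_factor {N : ℕ} (B : Matrix (Fin N) (Fin N) ℝ) (v : Fin N → ℝ) :
    ∃ B' : Matrix (Fin N) (Fin N) ℝ, B'.transpose * B' = B.transpose * B + Matrix.vecMulVec v v := by
  have h1 : (B.transpose * B).PosSemidef := by
    simpa [Matrix.conjTranspose_eq_transpose_of_trivial] using Matrix.posSemidef_conjTranspose_mul_self B
  have h2 : (Matrix.vecMulVec v v).PosSemidef := by
    simpa using Matrix.posSemidef_vecMulVec_self_star v
  obtain ⟨B', hB'⟩ := CStarAlgebra.nonneg_iff_eq_star_mul_self.mp (h1.add h2).nonneg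
  exact ⟨B', by rw [hB', Matrix.star_eq_conjTranspose, Matrix.conjTranspose_eq_transpose_of_trivial]⟩

lemma sumsq_matrix {N : ℕ} (B : Matrix (Fin N) (Fin N) ℝ) (w : Fin N → ℝ) :
    ∑ i, (∑ j, B i j * w j) ^ 2 = w ⬝ᵥ ((B.transpose * B).mulVec w) := by
  have : ∀ i, ∑ j, B i j * w j = (B.mulVec w) i := fun i => rfl
  simp only [this]
  rw [← Matrix.mulVec_mulVec, Matrix.mulVec_transpose, dotProduct_comm, ← Matrix.dotProduct_mulVec]
  simp [dotProduct, pow_two]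

lemma sumsq_trace {N : ℕ} (B : Matrix (Fin N) (Fin N) ℝ) :
    ∑ i, ∑ j, B i j ^ 2 = (B.transpose * B).trace := by
  simp only [Matrix.trace, Matrix.diag, Matrix.mul_apply, Matrix.transpose_apply]
  rw [Finset.sum_comm]
  simp [pow_two]

theorem sos_of_sqBelow (k : ℕ)
    (H : ∀ F : Pol, F.IsHomogeneous (k * 2) → Psd F → F ≠ 0 →
      ∃ q : Pol, q.IsHomogeneous k ∧ q ≠ 0 ∧ Psd (F - q ^ 2))
    (F : Pol) (hF : F.IsHomogeneous (k * 2)) (hp : Psd F) : Sos F := by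
  classical
  let N := Module.finrank ℝ (Hm k)
  let b := Module.finBasis ℝ (Hm k)
  let r : (Fin N → Fin N → ℝ) → Fin N → Pol := fun B i => ∑ j, B i j • (b j).1
  have hr : ∀ B i, (r B i).IsHomogeneous k := fun B i =>
    (Hm k).sum_mem fun j _ => (Hm k).smul_mem _ (b j).2
  have er : ∀ B i u, eval u (r B i) = ∑ j, B i j * eval u (b j).1 := by
    intro B i u; simp [r, smul_eval]
  let Gd := Fintype.piFinset (fun _ : Fin 3 => (Finset.range (k + 1)).image (Nat.cast : ℕ → ℝ))
  let Λ : (Fin N → Fin N → ℝ) →ₗ[ℝ] (Gd → Fin N → ℝ) :=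
    { toFun := fun B u i => ∑ j, B i j * eval u.1 (b j).1
      map_add' := by intro x y; ext u i; simp [add_mul, Finset.sum_add_distrib]
      map_smul' := by intro c x; ext u i; simp [mul_assoc, Finset.mul_sum] }
  have hΛ : Function.Injective Λ := by
    rw [← LinearMap.ker_eq_bot, LinearMap.ker_eq_bot']
    intro B hB
    ext i j
    have h0 : r B i = 0 := by
      refine grid_zero (hr B i) fun u hu => ?_
      rw [er]
      exact congrFun (congrFun hB ⟨u, hu⟩) i
    have h1 : ∑ j, B i j • b j = 0 := by
      ext1; simpa [r] using h0
    exact Fintype.linearIndependent_iff.1 b.linearIndependent _ h1 j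
  let GG : Set (Fin N → Fin N → ℝ) :=
    {B | ∀ u : Fin 3 → ℝ, ∑ i, (∑ j, B i j * eval u (b j).1) ^ 2 ≤ eval u F}
  have hclosed : IsClosed GG := by
    have : GG = ⋂ u : Fin 3 → ℝ, {B | ∑ i, (∑ j, B i j * eval u (b j).1) ^ 2 ≤ eval u F} := by
      ext B; simp only [GG, Set.mem_iInter]; rfl
    rw [this]
    exact isClosed_iInter fun u => isClosed_le (by fun_prop) continuous_const
  have hcomp : IsCompact GG := by
    let KK : Set (Gd → Fin N → ℝ) := Set.pi Set.univ fun u => Set.pi Set.univ fun _ =>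
      Set.Icc (-Real.sqrt (eval u.1 F)) (Real.sqrt (eval u.1 F))
    have hKK : IsCompact KK := isCompact_univ_pi fun u => isCompact_univ_pi fun _ => isCompact_Icc
    have hemb := LinearMap.isClosedEmbedding_of_injective (LinearMap.ker_eq_bot.2 hΛ)
    refine (hemb.isCompact_preimage hKK).of_isClosed_subset hclosed ?_
    intro B hB u _ i _
    have h1 : (∑ j, B i j * eval u.1 (b j).1) ^ 2 ≤ eval u.1 F :=
      (Finset.single_le_sum (f := fun i => (∑ j, B i j * eval u.1 (b j).1) ^ 2)
        (fun i _ => sq_nonneg _) (Finset.mem_univ i)).trans (hB u.1)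
    have h2 := Real.abs_le_sqrt h1
    exact abs_le.1 h2
  obtain ⟨B, hBG, hBmax⟩ := hcomp.exists_isMaxOn (f := fun B => ∑ i, ∑ j, B i j ^ 2)
    ⟨0, fun u => by simpa using hp u⟩ (by fun_prop)
  by_cases hz : F - ∑ i, (r B i) ^ 2 = 0
  · exact ⟨N, r B, sub_eq_zero.1 hz⟩
  exfalso
  obtain ⟨q, hq, hq0, hqp⟩ := H (F - ∑ i, (r B i) ^ 2)
    (hF.sub (IsHomogeneous.sum _ _ _ fun i _ => (hr B i).pow 2))
    (by intro u; have := hBG u; simp only [map_sub, map_sum, map_pow, er]; linarith) hz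
  let v : Fin N → ℝ := fun j => b.repr ⟨q, hq⟩ j
  have hqv : ∀ u, eval u q = ∑ j, v j * eval u (b j).1 := by
    intro u
    have h1 := congrArg Subtype.val (b.sum_repr ⟨q, hq⟩)
    have h2 : ∑ j, v j • (b j).1 = q := by
      rw [← Submodule.coe_subtype, map_sum] at h1; exact h1
    rw [← h2]; simp [smul_eval]
  obtain ⟨B', hB'⟩ := posSemidef_real_factor B v
  have hB'G : B' ∈ GG := by
    intro u
    have h1 := sumsq_matrix B' (fun j => eval u (b j).1)
    rw [hB', Matrix.add_mulVec, dotProduct_add, ← sumsq_matrix B] at h1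
    have h2 : (fun j => eval u (b j).1) ⬝ᵥ (Matrix.vecMulVec v v).mulVec (fun j => eval u (b j).1)
        = (eval u q) ^ 2 := by
      rw [Matrix.vecMulVec_mulVec, hqv]
      simp only [dotProduct, Pi.smul_apply]
      simp [pow_two, Finset.mul_sum, Finset.sum_mul]
      refine Finset.sum_congr rfl fun i _ => Finset.sum_congr rfl fun j _ => by ring
    rw [h2] at h1
    have h3 := hqp u
    simp only [map_sub, map_sum, map_pow, er] at h3
    linarith
  have h1 : ∑ i, ∑ j, B' i j ^ 2 ≤ ∑ i, ∑ j, B i j ^ 2 := hBmax hB'G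
  have h2 := sumsq_trace B
  have h3 := sumsq_trace B'
  rw [hB', Matrix.trace_add, ← h2] at h3
  have h4 : (Matrix.vecMulVec v v).trace = ∑ i, v i ^ 2 := by
    simp [Matrix.trace, Matrix.vecMulVec_apply, pow_two]
  have h5 : ∑ i, v i ^ 2 = 0 := le_antisymm (by linarith) (Finset.sum_nonneg fun i _ => sq_nonneg _)
  apply hq0
  apply MvPolynomial.funext
  intro u
  rw [hqv]
  have h6 := (Finset.sum_eq_zero_iff_of_nonneg (fun i _ => sq_nonneg (v i))).1 h5
  rw [map_zero]
  refine Finset.sum_eq_zero fun i hi => ?_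
  have := h6 i hi
  rw [pow_eq_zero_iff two_ne_zero] at this
  rw [this, zero_mul]

/-- some nonzero square lies below `F` -/
def QB (k : ℕ) (F : Pol) : Prop := ∃ q : Pol, q.IsHomogeneous k ∧ q ≠ 0 ∧ Psd (F - q ^ 2)

lemma vec3 (u : Fin 3 → ℝ) : u = ![u 0, u 1, u 2] := by ext i; fin_cases i <;> rfl

lemma rep_succ {n : ℕ} {F : Pol} (hF : F.IsHomogeneous (n + 1)) :
    ∃ G0 G1 G2 : Pol, G0.IsHomogeneous n ∧ G1.IsHomogeneous n ∧ G2.IsHomogeneous n ∧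
      ∀ x y z : ℝ, eval ![x, y, z] F =
        x * eval ![x, y, z] G0 + y * eval ![x, y, z] G1 + z * eval ![x, y, z] G2 := by
  have h : ∀ i, (C (1 / ((n : ℝ) + 1)) * pderiv i F).IsHomogeneous n := fun i =>
    IsHomogeneous.C_mul (hF.pderiv) _
  refine ⟨_, _, _, h 0, h 1, h 2, fun x y z => ?_⟩
  have h1 := grad_euler hF ![x, y, z]
  simp [grad, dotProduct, Fin.sum_univ_three] at h1
  have hn : (n : ℝ) + 1 ≠ 0 := by positivity
  simp only [map_mul, eval_C]
  field_simp
  linarith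

lemma rep0 {F : Pol} (hF : F.IsHomogeneous 0) : ∃ a : ℝ, ∀ x y z : ℝ, eval ![x, y, z] F = a := by
  rw [← totalDegree_zero_iff_isHomogeneous, totalDegree_eq_zero_iff_eq_C] at hF
  exact ⟨coeff 0 F, fun x y z => by rw [hF]; simp⟩

lemma rep1 {F : Pol} (hF : F.IsHomogeneous 1) :
    ∃ a b c : ℝ, ∀ x y z : ℝ, eval ![x, y, z] F = a * x + b * y + c * z := by
  obtain ⟨G0, G1, G2, h0, h1, h2, h⟩ := rep_succ hF
  obtain ⟨a, ha⟩ := rep0 h0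
  obtain ⟨b, hb⟩ := rep0 h1
  obtain ⟨c, hc⟩ := rep0 h2
  exact ⟨a, b, c, fun x y z => by rw [h, ha, hb, hc]; ring⟩

lemma rep2 {F : Pol} (hF : F.IsHomogeneous 2) :
    ∃ a b c d e f : ℝ, ∀ x y z : ℝ, eval ![x, y, z] F =
      a * x ^ 2 + b * y ^ 2 + c * z ^ 2 + d * x * y + e * x * z + f * y * z := by
  obtain ⟨G0, G1, G2, h0, h1, h2, h⟩ := rep_succ hF
  obtain ⟨a0, b0, c0, e0⟩ := rep1 h0
  obtain ⟨a1, b1, c1, e1⟩ := rep1 h1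
  obtain ⟨a2, b2, c2, e2⟩ := rep1 h2
  exact ⟨a0, b1, c2, b0 + a1, c0 + a2, c1 + b2, fun x y z => by rw [h, e0, e1, e2]; ring⟩

lemma rep3 {F : Pol} (hF : F.IsHomogeneous 3) :
    ∃ a b c d e f g h i j : ℝ, ∀ x y z : ℝ, eval ![x, y, z] F =
      a * x ^ 3 + x ^ 2 * (b * y + c * z) + x * (d * y ^ 2 + e * y * z + f * z ^ 2)
      + (g * y ^ 3 + h * y ^ 2 * z + i * y * z ^ 2 + j * z ^ 3) := by
  obtain ⟨G0, G1, G2, h0, h1, h2, h⟩ := rep_succ hF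
  obtain ⟨a0, b0, c0, d0, e0, f0, r0⟩ := rep2 h0
  obtain ⟨a1, b1, c1, d1, e1, f1, r1⟩ := rep2 h1
  obtain ⟨a2, b2, c2, d2, e2, f2, r2⟩ := rep2 h2
  exact ⟨a0, d0 + a1, e0 + a2, b0 + d1, f0 + e1 + d2, c0 + e2, b1, f1 + b2, c1 + f2, c2,
    fun x y z => by rw [h, r0, r1, r2]; ring⟩

lemma rep4 {F : Pol} (hF : F.IsHomogeneous 4) :
    ∃ c0 c1 c2 a b c p q r s h0 h1 h2 h3 h4 : ℝ, ∀ x y z : ℝ, eval ![x, y, z] F =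
      c0 * x ^ 4 + x ^ 3 * (c1 * y + c2 * z) + x ^ 2 * (a * y ^ 2 + b * y * z + c * z ^ 2)
      + x * (p * y ^ 3 + q * y ^ 2 * z + r * y * z ^ 2 + s * z ^ 3)
      + (h0 * y ^ 4 + h1 * y ^ 3 * z + h2 * y ^ 2 * z ^ 2 + h3 * y * z ^ 3 + h4 * z ^ 4) := by
  obtain ⟨G0, G1, G2, h0, h1, h2, h⟩ := rep_succ hF
  obtain ⟨a0, b0, c0, d0, e0, f0, g0, i0, j0, k0, r0⟩ := rep3 h0
  obtain ⟨a1, b1, c1, d1, e1, f1, g1, i1, j1, k1, r1⟩ := rep3 h1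
  obtain ⟨a2, b2, c2, d2, e2, f2, g2, i2, j2, k2, r2⟩ := rep3 h2
  exact ⟨a0, b0 + a1, c0 + a2, d0 + b1, e0 + c1 + b2, f0 + c2, g0 + d1, i0 + e1 + d2,
    j0 + f1 + e2, k0 + f2, g1, i1 + g2, j1 + i2, k1 + j2, k2,
    fun x y z => by rw [h, r0, r1, r2]; ring⟩

lemma quad_nonneg {a b c : ℝ} (h : ∀ t : ℝ, 0 ≤ a * t ^ 2 + b * t + c) :
    0 ≤ a ∧ 0 ≤ c ∧ b ^ 2 ≤ 4 * a * c := by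
  have hd : discrim a b c ≤ 0 := discrim_le_zero fun t => by have := h t; nlinarith
  unfold discrim at hd
  have hc : 0 ≤ c := by simpa using h 0
  refine ⟨?_, hc, by linarith⟩
  by_contra ha
  push Not at ha
  have h1 : b ^ 2 ≤ 0 := by nlinarith
  have hb : b = 0 := by nlinarith
  subst hb
  have h2 := h (1 + (c + 1) / (-a))
  have h3 : (c + 1) / (-a) * (-a) = c + 1 := div_mul_cancel₀ _ (by linarith)
  have h4 : 0 < (c + 1) / (-a) := div_pos (by linarith) (by linarith)
  nlinarith

lemma cubic_nonneg {a b c d : ℝ} (h : ∀ t : ℝ, 0 ≤ a * t ^ 3 + b * t ^ 2 + c * t + d) : a = 0 := by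
  -- compare t and -t with t large
  by_contra ha
  have key : ∀ t : ℝ, 0 < t → |a| * t ^ 3 ≤ |b| * t ^ 2 + |c| * t + |d| := by
    intro t ht
    have h1 := h t
    have h2 := h (-t)
    have h3 := mul_le_mul_of_nonneg_right (le_abs_self b) (sq_nonneg t)
    have h4 := mul_le_mul_of_nonneg_right (le_abs_self c) ht.le
    have h5 := mul_le_mul_of_nonneg_right (neg_abs_le c) ht.le
    have h6 := le_abs_self d
    rcases abs_cases a with ⟨e, _⟩ | ⟨e, _⟩ <;> rw [e] <;> nlinarith
  have ha' : 0 < |a| := abs_pos.2 ha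
  have hb := abs_nonneg b
  have hc := abs_nonneg c
  have hd := abs_nonneg d
  set t := (|b| + |c| + |d|) / |a| + 1 with ht
  have ht1 : 1 ≤ t := by rw [ht]; have : 0 ≤ (|b| + |c| + |d|) / |a| := by positivity
                         linarith
  have h1 : |a| * t = |b| + |c| + |d| + |a| := by rw [ht]; field_simp
  have h2 := key t (by linarith)
  have h3 : |a| * t ^ 3 = (|b| + |c| + |d| + |a|) * t ^ 2 := by rw [← h1]; ring
  have h4 : t ≤ t ^ 2 := by nlinarith
  have h5 : 1 ≤ t ^ 2 := by nlinarith
  nlinarith [mul_le_mul_of_nonneg_left h4 hc, mul_le_mul_of_nonneg_left h5 hd]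

lemma QB_explicit {F : Pol} (κ : ℝ) (hκ : 0 < κ) (A B C' D E G : ℝ)
    (hne : ∃ x y z : ℝ, A * x ^ 2 + B * y ^ 2 + C' * z ^ 2 + D * x * y + E * x * z + G * y * z ≠ 0)
    (h : ∀ x y z : ℝ, κ * (A * x ^ 2 + B * y ^ 2 + C' * z ^ 2 + D * x * y + E * x * z + G * y * z) ^ 2
      ≤ eval ![x, y, z] F) : QB 2 F := by
  let q0 : Pol := C A * X 0 ^ 2 + C B * X 1 ^ 2 + C C' * X 2 ^ 2 + C D * (X 0 * X 1)
    + C E * (X 0 * X 2) + C G * (X 1 * X 2)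
  have hX : ∀ i : Fin 3, (X i : Pol).IsHomogeneous 1 := fun i => isHomogeneous_X _ _
  have hq0 : q0.IsHomogeneous 2 := by
    refine (((((?_ : IsHomogeneous _ 2).add ?_).add ?_).add ?_).add ?_).add ?_
    · exact ((hX 0).pow 2).C_mul _
    · exact ((hX 1).pow 2).C_mul _
    · exact ((hX 2).pow 2).C_mul _
    · exact ((hX 0).mul (hX 1)).C_mul _
    · exact ((hX 0).mul (hX 2)).C_mul _
    · exact ((hX 1).mul (hX 2)).C_mul _
  have he : ∀ x y z : ℝ, eval ![x, y, z] q0 =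
      A * x ^ 2 + B * y ^ 2 + C' * z ^ 2 + D * x * y + E * x * z + G * y * z := by
    intro x y z; simp [q0]; ring
  refine ⟨C (Real.sqrt κ) * q0, hq0.C_mul _, ?_, ?_⟩
  · obtain ⟨x, y, z, hxyz⟩ := hne
    rw [← he] at hxyz
    have : q0 ≠ 0 := by rintro h0; rw [h0] at hxyz; simp at hxyz
    refine mul_ne_zero ?_ this
    rw [Ne, C_eq_zero]; exact (Real.sqrt_pos.2 hκ).ne'
  · intro u
    rw [vec3 u]
    have := h (u 0) (u 1) (u 2)
    rw [map_sub, map_pow, map_mul, eval_C, mul_pow, Real.sq_sqrt hκ.le, he]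
    linarith

/-- change of coordinates -/
lemma change {F : Pol} {n k : ℕ} (hF : F.IsHomogeneous n) (p1 p2 : Fin 3 → ℝ)
    (hp : crossProduct p1 p2 ≠ 0) :
    ∃ F' : Pol, F'.IsHomogeneous n ∧ (F ≠ 0 → F' ≠ 0) ∧ (Psd F → Psd F') ∧
      (QB k F' → QB k F) ∧ ∀ x y z : ℝ, eval ![x, y, z] F' =
      eval (x • p1 + y • p2 + z • crossProduct p1 p2) F := by
  let M : Matrix (Fin 3) (Fin 3) ℝ := Matrix.transpose (Matrix.of ![p1, p2, crossProduct p1 p2])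
  have hdet : M.det ≠ 0 := by
    have h1 : crossProduct p1 p2 ⬝ᵥ crossProduct p1 p2 ≠ 0 := by
      rwa [Ne, dotProduct_self_eq_zero]
    intro h
    apply h1
    rw [← h, Matrix.det_transpose, Matrix.det_fin_three]
    simp [cross_apply, dotProduct, Fin.sum_univ_three]
    ring
  have hun : IsUnit M.det := isUnit_iff_ne_zero.2 hdet
  let sub : Matrix (Fin 3) (Fin 3) ℝ → Pol → Pol := fun M F => aeval (fun i => lin (M i)) F
  have hsub : ∀ M F u, eval u (sub M F) = eval (M.mulVec u) F := by
    intro M F u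
    simp only [sub]
    rw [aeval_def, ← coe_eval₂Hom, ← RingHom.comp_apply]
    have : (eval u).comp (eval₂Hom (algebraMap ℝ Pol) fun i => lin (M i)) = eval (M.mulVec u) := by
      apply ringHom_ext
      · intro r; simp [algebraMap_eq]
      · intro i; simp [eval_lin, Matrix.mulVec]
    rw [this]
  have hhom : ∀ M F j, F.IsHomogeneous j → (sub M F).IsHomogeneous j := by
    intro M F j hF
    have := hF.aeval (fun i => lin (M i)) (n := 1) (fun i => lin_hom _)
    rwa [one_mul] at this
  refine ⟨sub M F, hhom _ _ _ hF, ?_, ?_, ?_, ?_⟩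
  · intro h0 h
    apply h0
    apply MvPolynomial.funext
    intro u
    have := congrArg (eval (M⁻¹.mulVec u)) h
    rw [hsub, Matrix.mulVec_mulVec, Matrix.mul_nonsing_inv _ hun, Matrix.one_mulVec] at this
    simpa using this
  · intro h u
    rw [hsub]
    exact h _
  · rintro ⟨q, hq, hq0, hqp⟩
    refine ⟨sub M⁻¹ q, hhom _ _ _ hq, ?_, ?_⟩
    · intro h
      apply hq0
      apply MvPolynomial.funext
      intro u
      have := congrArg (eval (M.mulVec u)) h
      rw [hsub, Matrix.mulVec_mulVec, Matrix.nonsing_inv_mul _ hun, Matrix.one_mulVec] at this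
      simpa using this
    · intro u
      have := hqp (M⁻¹.mulVec u)
      rw [map_sub, map_pow] at this ⊢
      rwa [hsub, Matrix.mulVec_mulVec, Matrix.mul_nonsing_inv _ hun, Matrix.one_mulVec, ← hsub] at this
  · intro x y z
    rw [hsub]
    congr 2
    ext i
    fin_cases i <;> simp [M, Matrix.mulVec, dotProduct, Fin.sum_univ_three] <;> ring

lemma sphere_bound {F : Pol} {k : ℕ} (hF : F.IsHomogeneous (2 * k))
    (h : ∀ u : Fin 3 → ℝ, u ≠ 0 → 0 < eval u F) :
    ∃ ε > 0, ∀ x y z : ℝ, ε * (x ^ 2 + y ^ 2 + z ^ 2) ^ k ≤ eval ![x, y, z] F := by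
  let K : Set (Fin 3 → ℝ) := {u | u 0 ^ 2 + u 1 ^ 2 + u 2 ^ 2 = 1}
  have hK : IsCompact K := by
    refine Metric.isCompact_of_isClosed_isBounded (isClosed_eq (by fun_prop) continuous_const) ?_
    refine (Metric.isBounded_closedBall (x := (0 : Fin 3 → ℝ)) (r := 1)).subset ?_
    intro u hu
    have hu' : u 0 ^ 2 + u 1 ^ 2 + u 2 ^ 2 = 1 := hu
    rw [mem_closedBall_zero_iff, pi_norm_le_iff_of_nonneg zero_le_one]
    intro i
    rw [Real.norm_eq_abs, ← sq_le_one_iff_abs_le_one]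
    fin_cases i <;> [change u 0 ^ 2 ≤ 1; change u 1 ^ 2 ≤ 1; change u 2 ^ 2 ≤ 1] <;>
      nlinarith [sq_nonneg (u 0), sq_nonneg (u 1), sq_nonneg (u 2)]
  have hne : K.Nonempty := ⟨![1, 0, 0], by simp [K]⟩
  obtain ⟨m, hm, hmin⟩ := hK.exists_isMinOn hne (cont_eval F).continuousOn
  have hm0 : m ≠ 0 := by
    rintro rfl
    simp [K] at hm
  refine ⟨eval m F, h m hm0, fun x y z => ?_⟩
  by_cases hz : x ^ 2 + y ^ 2 + z ^ 2 = 0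
  · have hx : x = 0 := by nlinarith [sq_nonneg x, sq_nonneg y, sq_nonneg z]
    have hy : y = 0 := by nlinarith [sq_nonneg x, sq_nonneg y, sq_nonneg z]
    have hz' : z = 0 := by nlinarith [sq_nonneg x, sq_nonneg y, sq_nonneg z]
    subst hx hy hz'
    have e : (![0, 0, 0] : Fin 3 → ℝ) = (0 : ℝ) • m := by ext i; fin_cases i <;> simp
    rw [e, eval_smul_hom hF]
    rcases k with _ | k <;> simp
  · have hp : 0 < x ^ 2 + y ^ 2 + z ^ 2 := lt_of_le_of_ne (by positivity) (Ne.symm hz)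
    set r := Real.sqrt (x ^ 2 + y ^ 2 + z ^ 2) with hr
    have hr0 : 0 < r := Real.sqrt_pos.2 hp
    have hr2 : r ^ 2 = x ^ 2 + y ^ 2 + z ^ 2 := Real.sq_sqrt hp.le
    have e : (![x, y, z] : Fin 3 → ℝ) = r • ![x / r, y / r, z / r] := by
      ext i; fin_cases i <;> simp <;> field_simp
    have hmem : (![x / r, y / r, z / r] : Fin 3 → ℝ) ∈ K := by
      simp only [K, Set.mem_ofPred_eq]
      simp
      field_simp
      linarith
    have := hmin hmem
    rw [e, eval_smul_hom hF, ← hr2, ← pow_mul, mul_comm]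
    exact mul_le_mul_of_nonneg_left this (by positivity)

lemma circle_bound (φ : ℝ → ℝ → ℝ) (k : ℕ) (hc : Continuous fun p : ℝ × ℝ => φ p.1 p.2)
    (hh : ∀ t y z, φ (t * y) (t * z) = t ^ (2 * k) * φ y z)
    (h : ∀ y z, (y ≠ 0 ∨ z ≠ 0) → 0 < φ y z) :
    ∃ ε > 0, ∀ y z : ℝ, (y ≠ 0 ∨ z ≠ 0) → ε * (y ^ 2 + z ^ 2) ^ k ≤ φ y z := by
  let K : Set (ℝ × ℝ) := {u | u.1 ^ 2 + u.2 ^ 2 = 1}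
  have hK : IsCompact K := by
    refine Metric.isCompact_of_isClosed_isBounded (isClosed_eq (by fun_prop) continuous_const) ?_
    refine (Metric.isBounded_closedBall (x := (0 : ℝ × ℝ)) (r := 1)).subset ?_
    intro u hu
    have hu' : u.1 ^ 2 + u.2 ^ 2 = 1 := hu
    rw [mem_closedBall_zero_iff, Prod.norm_def, Real.norm_eq_abs, Real.norm_eq_abs]
    refine max_le ?_ ?_ <;> rw [← sq_le_one_iff_abs_le_one] <;>
      nlinarith [sq_nonneg u.1, sq_nonneg u.2]
  have hne : K.Nonempty := ⟨(1, 0), by simp [K]⟩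
  obtain ⟨m, hm, hmin⟩ := hK.exists_isMinOn hne hc.continuousOn
  have hm0 : m.1 ≠ 0 ∨ m.2 ≠ 0 := by
    by_contra hcon
    push Not at hcon
    have hm' : m.1 ^ 2 + m.2 ^ 2 = 1 := hm
    rw [hcon.1, hcon.2] at hm'
    norm_num at hm'
  refine ⟨φ m.1 m.2, h _ _ hm0, fun y z hyz => ?_⟩
  have hp : 0 < y ^ 2 + z ^ 2 := by
    rcases hyz with hy | hz
    · positivity
    · positivity
  set r := Real.sqrt (y ^ 2 + z ^ 2) with hr
  have hr0 : 0 < r := Real.sqrt_pos.2 hp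
  have hr2 : r ^ 2 = y ^ 2 + z ^ 2 := Real.sq_sqrt hp.le
  have hmem : (y / r, z / r) ∈ K := by
    simp only [K, Set.mem_ofPred_eq]
    field_simp
    linarith
  have h1 : φ m.1 m.2 ≤ φ (y / r) (z / r) := hmin hmem
  have h2 := hh r (y / r) (z / r)
  rw [mul_div_cancel₀ _ hr0.ne', mul_div_cancel₀ _ hr0.ne'] at h2
  rw [h2, ← hr2, ← pow_mul, mul_comm]
  exact mul_le_mul_of_nonneg_left h1 (by positivity)

lemma nonneg_of_punct {φ : ℝ → ℝ} (hc : Continuous φ) (h : ∀ t, t ≠ 0 → 0 ≤ φ t) : 0 ≤ φ 0 := by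
  have hcl : IsClosed {t | 0 ≤ φ t} := isClosed_le continuous_const hc
  have hd : Dense ({0}ᶜ : Set ℝ) := dense_compl_singleton 0
  have : closure ({0}ᶜ : Set ℝ) ⊆ {t | 0 ≤ φ t} := hcl.closure_subset_iff.2 (fun t ht => h t ht)
  rw [hd.closure_eq] at this
  exact this (Set.mem_univ 0)

lemma psd_xyz {F : Pol} (h : Psd F) (x y z : ℝ) : 0 ≤ eval ![x, y, z] F := h _

lemma rep_e1 {F : Pol} (hF : F.IsHomogeneous 4) (hp : Psd F) (h1 : eval ![1, 0, 0] F = 0) :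
    ∃ a b c p q r s h0 h1 h2 h3 h4 : ℝ, ∀ x y z : ℝ, eval ![x, y, z] F =
      x ^ 2 * (a * y ^ 2 + b * y * z + c * z ^ 2)
      + x * (p * y ^ 3 + q * y ^ 2 * z + r * y * z ^ 2 + s * z ^ 3)
      + (h0 * y ^ 4 + h1 * y ^ 3 * z + h2 * y ^ 2 * z ^ 2 + h3 * y * z ^ 3 + h4 * z ^ 4) := by
  obtain ⟨c0, c1, c2, a, b, c, p, q, r, s, k0, k1, k2, k3, k4, h⟩ := rep4 hF
  have e0 : c0 = 0 := by rw [h] at h1; linarith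
  subst e0
  have e1 : c1 = 0 := by
    apply cubic_nonneg (b := a) (c := p) (d := k0)
    intro t
    have := psd_xyz hp t 1 0
    rw [h] at this
    linarith
  have e2 : c2 = 0 := by
    apply cubic_nonneg (b := c) (c := s) (d := k4)
    intro t
    have := psd_xyz hp t 0 1
    rw [h] at this
    linarith
  subst e1 e2
  exact ⟨a, b, c, p, q, r, s, k0, k1, k2, k3, k4, fun x y z => by rw [h]; ring⟩

lemma ex_ne {F : Pol} (h : F ≠ 0) : ∃ x y z : ℝ, eval ![x, y, z] F ≠ 0 := by
  by_contra hc
  push Not at hc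
  exact h (MvPolynomial.funext fun u => by rw [vec3 u, hc]; simp)

lemma LB {F : Pol} (hF : F.IsHomogeneous 4) (hp : Psd F) (hne : F ≠ 0)
    (h1 : eval ![1, 0, 0] F = 0) (L K : ℝ) (hL : ∀ x, eval ![x, 1, 0] F = L * x + K) : QB 2 F := by
  obtain ⟨a, b, c, p, q, r, s, k0, k1, k2, k3, k4, h⟩ := rep_e1 hF hp h1
  have ea : a = 0 := by
    have h1 := hL 1
    have h2 := hL (-1)
    have h3 := hL 0
    rw [h] at h1 h2 h3
    linarith
  subst ea
  have ep : p = 0 := by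
    have := (quad_nonneg (a := 0) (b := p) (c := k0) fun t => by
      have := psd_xyz hp t 1 0
      rw [h] at this
      linarith).2.2
    nlinarith
  subst ep
  have key : ∀ y z, 0 ≤ b * y * z + c * z ^ 2 ∧
      (q * y ^ 2 * z + r * y * z ^ 2 + s * z ^ 3) ^ 2 ≤ 4 * (b * y * z + c * z ^ 2) *
        (k0 * y ^ 4 + k1 * y ^ 3 * z + k2 * y ^ 2 * z ^ 2 + k3 * y * z ^ 3 + k4 * z ^ 4) := by
    intro y z
    have := quad_nonneg (a := b * y * z + c * z ^ 2)
      (b := q * y ^ 2 * z + r * y * z ^ 2 + s * z ^ 3)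
      (c := k0 * y ^ 4 + k1 * y ^ 3 * z + k2 * y ^ 2 * z ^ 2 + k3 * y * z ^ 3 + k4 * z ^ 4)
      fun t => by
        have := psd_xyz hp t y z
        rw [h] at this
        linarith
    exact ⟨this.1, this.2.2⟩
  have eb : b = 0 := by
    have := (quad_nonneg (a := 0) (b := b) (c := c) fun t => by
      have := (key t 1).1
      linarith).2.2
    nlinarith
  subst eb
  have hc : 0 ≤ c := by have := (key 0 1).1; linarith
  have hh : ∀ y z, 0 ≤ k0 * y ^ 4 + k1 * y ^ 3 * z + k2 * y ^ 2 * z ^ 2 + k3 * y * z ^ 3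
      + k4 * z ^ 4 := by
    intro y z
    have := psd_xyz hp 0 y z
    rw [h] at this
    linarith
  have disc : ∀ y z, 0 ≤ 4 * c * (k0 * y ^ 4 + k1 * y ^ 3 * z + k2 * y ^ 2 * z ^ 2 + k3 * y * z ^ 3
      + k4 * z ^ 4) - (q * y ^ 2 + r * y * z + s * z ^ 2) ^ 2 := by
    intro y
    have d0 : ∀ z, z ≠ 0 → 0 ≤ 4 * c * (k0 * y ^ 4 + k1 * y ^ 3 * z + k2 * y ^ 2 * z ^ 2
        + k3 * y * z ^ 3 + k4 * z ^ 4) - (q * y ^ 2 + r * y * z + s * z ^ 2) ^ 2 := by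
      intro z hz
      have := (key y z).2
      have hz2 : 0 < z ^ 2 := by positivity
      refine nonneg_of_mul_nonneg_right (a := z ^ 2) ?_ hz2
      linarith
    intro z
    by_cases hz : z = 0
    · subst hz
      exact nonneg_of_punct (φ := fun z => 4 * c * (k0 * y ^ 4 + k1 * y ^ 3 * z
        + k2 * y ^ 2 * z ^ 2 + k3 * y * z ^ 3 + k4 * z ^ 4)
        - (q * y ^ 2 + r * y * z + s * z ^ 2) ^ 2) (by fun_prop) d0
    · exact d0 z hz
  rcases hc.lt_or_eq with hc | hc
  · refine QB_explicit (1 / (4 * c)) (by positivity) 0 q s 0 (2 * c) r ?_ ?_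
    · refine ⟨(1 - s) / (2 * c), 0, 1, ?_⟩
      have : 2 * c * ((1 - s) / (2 * c)) = 1 - s := mul_div_cancel₀ _ (by positivity)
      have : 0 * ((1 - s) / (2 * c)) ^ 2 + q * 0 ^ 2 + s * 1 ^ 2 + 0 * ((1 - s) / (2 * c)) * 0
        + 2 * c * ((1 - s) / (2 * c)) * 1 + r * 0 * 1 = 1 := by rw [this]; ring
      rw [this]; norm_num
    · intro x y z
      rw [h, div_mul_eq_mul_div, div_le_iff₀ (by positivity)]
      have := disc y z
      linarith
  · subst hc
    have g0 : ∀ y z, q * y ^ 2 + r * y * z + s * z ^ 2 = 0 := by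
      intro y z
      have := disc y z
      nlinarith
    have eq0 : q = 0 := by have := g0 1 0; linarith
    have es : s = 0 := by have := g0 0 1; linarith
    have er : r = 0 := by have := g0 1 1; linarith
    subst eq0 es er
    by_cases hpos : ∀ y z, (y ≠ 0 ∨ z ≠ 0) → 0 < k0 * y ^ 4 + k1 * y ^ 3 * z + k2 * y ^ 2 * z ^ 2
        + k3 * y * z ^ 3 + k4 * z ^ 4
    · obtain ⟨ε, hε, hb⟩ := circle_bound (fun y z => k0 * y ^ 4 + k1 * y ^ 3 * z + k2 * y ^ 2 * z ^ 2
        + k3 * y * z ^ 3 + k4 * z ^ 4) 2 (by fun_prop) (fun t y z => by ring) hpos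
      refine QB_explicit ε hε 0 1 1 0 0 0 ⟨0, 1, 0, by norm_num⟩ fun x y z => ?_
      rw [h]
      by_cases hyz : y ≠ 0 ∨ z ≠ 0
      · have := hb y z hyz
        linarith
      · push Not at hyz
        rw [hyz.1, hyz.2]
        linarith
    · push Not at hpos
      obtain ⟨β, γ, hβγ, hle⟩ := hpos
      have hz0 := le_antisymm hle (hh β γ)
      have hcr : crossProduct ![0, β, γ] ![(1 : ℝ), 0, 0] = ![0, γ, -β] := by
        rw [cross_apply]; ext i; fin_cases i <;> simp
      have hcr0 : crossProduct ![0, β, γ] ![(1 : ℝ), 0, 0] ≠ 0 := by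
        rw [hcr]; intro h0
        have e1 := congrFun h0 1
        have e2 := congrFun h0 2
        simp at e1 e2
        tauto
      obtain ⟨F', hF', hne', hp', hQ, he⟩ := change (k := 2) hF _ _ hcr0
      apply hQ
      have he' : ∀ x y z, eval ![x, y, z] F' = eval ![y, x * β + z * γ, x * γ - z * β] F := by
        intro x y z
        rw [he, hcr]
        congr 2
        ext i; fin_cases i <;> simp
        ring
      have hind : ∀ x y z, eval ![x, y, z] F' = eval ![x, 0, z] F' := by
        intro x y z; rw [he', he', h, h]; ring
      have hz' : eval ![1, 0, 0] F' = 0 := by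
        rw [he', h]
        linear_combination hz0
      obtain ⟨a', b', c', p', q', r', s', l0, l1, l2, l3, l4, h'⟩ := rep_e1 hF' (hp' hp) hz'
      obtain ⟨n1, n2, n3⟩ := quad_nonneg (a := c') (b := s') (c := l4) fun t => by
        have := psd_xyz (hp' hp) t 0 1
        rw [h'] at this
        linarith
      have hfin : ∀ x y z, eval ![x, y, z] F' = z ^ 2 * (c' * x ^ 2 + s' * x * z + l4 * z ^ 2) := by
        intro x y z
        rw [hind, h']; ring
      rcases n1.lt_or_eq with n1 | n1
      · refine QB_explicit (1 / (4 * c')) (by positivity) 0 0 s' 0 (2 * c') 0 ?_ ?_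
        · by_contra hcon
          push Not at hcon
          have e1 := hcon 1 0 1
          have e2 := hcon 0 0 1
          linarith
        · intro x y z
          rw [hfin, div_mul_eq_mul_div, div_le_iff₀ (by positivity)]
          have := mul_nonneg (sub_nonneg.2 n3) (by positivity : 0 ≤ z ^ 4)
          linarith
      · subst n1
        have es : s' = 0 := by nlinarith
        subst es
        have hl4 : l4 ≠ 0 := by
          rintro rfl
          obtain ⟨x, y, z, hx⟩ := ex_ne (hne' hne)
          apply hx
          rw [hfin]; ring
        refine QB_explicit l4 (lt_of_le_of_ne n2 (Ne.symm hl4)) 0 0 1 0 0 0 ⟨0, 0, 1, by norm_num⟩ ?_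
        intro x y z
        rw [hfin]
        linarith

lemma LBw {F : Pol} (hF : F.IsHomogeneous 4) (hp : Psd F) (hne : F ≠ 0)
    (h1 : eval ![1, 0, 0] F = 0) (β γ : ℝ) (hβγ : β ≠ 0 ∨ γ ≠ 0)
    (L K : ℝ) (hL : ∀ x, eval ![x, β, γ] F = L * x + K) : QB 2 F := by
  have hcr : crossProduct ![(1 : ℝ), 0, 0] ![0, β, γ] ≠ 0 := by
    rw [cross_apply]; intro h0
    have e1 := congrFun h0 1
    have e2 := congrFun h0 2
    simp at e1 e2
    tauto
  obtain ⟨F', hF', hne', hp', hQ, he⟩ := change (k := 2) hF _ _ hcr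
  refine hQ (LB hF' (hp' hp) (hne' hne) ?_ L K ?_)
  · rw [he]; refine Eq.trans ?_ h1; congr 2; ext i; fin_cases i <;> simp
  · intro x
    rw [he, ← hL]; congr 2; ext i; fin_cases i <;> simp

lemma BL {A B D β γ : ℝ} (hβγ : β ≠ 0 ∨ γ ≠ 0) (h : A * β ^ 2 + B * β * γ + D * γ ^ 2 = 0) :
    ∃ m1 m2 : ℝ, ∀ y z, A * y ^ 2 + B * y * z + D * z ^ 2 = (γ * y - β * z) * (m1 * y + m2 * z) := by
  rcases hβγ with hb | hg
  · refine ⟨(-γ * D / β - B) / β, -D / β, fun y z => ?_⟩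
    have hA : A = -(B * β * γ + D * γ ^ 2) / β ^ 2 := by field_simp; linarith
    rw [hA]; field_simp; ring
  · refine ⟨A / γ, (B + β * (A / γ)) / γ, fun y z => ?_⟩
    have hD : D = -(A * β ^ 2 + B * β * γ) / γ ^ 2 := by field_simp; linarith
    rw [hD]; field_simp; ring

lemma BQ {A B D β γ : ℝ} (hβγ : β ≠ 0 ∨ γ ≠ 0) (h : A * β ^ 2 + B * β * γ + D * γ ^ 2 = 0)
    (hp : ∀ y z, 0 ≤ A * y ^ 2 + B * y * z + D * z ^ 2) :
    ∃ μ : ℝ, 0 ≤ μ ∧ ∀ y z, A * y ^ 2 + B * y * z + D * z ^ 2 = μ * (γ * y - β * z) ^ 2 := by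
  have hA : 0 ≤ A := by have := hp 1 0; linarith
  have hD : 0 ≤ D := by have := hp 0 1; linarith
  have e1 : 2 * A * β + B * γ = 0 := by
    have := (quad_nonneg (a := A) (b := 2 * A * β + B * γ) (c := 0) fun t => by
      have := hp (β + t) γ
      linarith).2.2
    nlinarith
  have e2 : B * β + 2 * D * γ = 0 := by
    have := (quad_nonneg (a := D) (b := B * β + 2 * D * γ) (c := 0) fun t => by
      have := hp β (γ + t)
      linarith).2.2
    nlinarith
  rcases hβγ with hb | hg
  · refine ⟨D / β ^ 2, by positivity, fun y z => ?_⟩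
    have hB : B = -(2 * D * γ) / β := by field_simp; linarith
    have hA : A = -B * γ / (2 * β) := by field_simp; linarith
    rw [hA, hB]; field_simp; ring
  · refine ⟨A / γ ^ 2, by positivity, fun y z => ?_⟩
    have hB : B = -(2 * A * β) / γ := by field_simp; linarith
    have hD : D = -B * β / (2 * γ) := by field_simp; linarith
    rw [hD, hB]; field_simp; ring

lemma trace_bound {a b c : ℝ} (hp : ∀ y z, 0 ≤ a * y ^ 2 + b * y * z + c * z ^ 2) (y z : ℝ) :
    a * y ^ 2 + b * y * z + c * z ^ 2 ≤ (a + c) * (y ^ 2 + z ^ 2) := by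
  have := hp z (-y)
  linarith


lemma ex_root {f g : ℝ} (h : f ≠ 0) : ∃ α : ℝ, g + 2 * α * f = 0 :=
  ⟨-g / (2 * f), by field_simp; ring⟩

lemma L2 {F : Pol} (hF : F.IsHomogeneous 4) (hp : Psd F) (hne : F ≠ 0)
    (h1 : eval ![1, 0, 0] F = 0) (h2 : eval ![0, 1, 0] F = 0) : QB 2 F := by
  obtain ⟨a, b, c, p, q, r, s, k0, k1, k2, k3, k4, h⟩ := rep_e1 hF hp h1
  have e0 : k0 = 0 := by rw [h] at h2; linarith
  subst e0
  have e1 : k1 = 0 := by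
    apply cubic_nonneg (b := k2) (c := k3) (d := k4)
    intro t
    have := psd_xyz hp 0 t 1
    rw [h] at this
    linarith
  subst e1
  have ep : p = 0 := by
    apply cubic_nonneg (b := a + q + k2) (c := b + r + k3) (d := c + s + k4)
    intro t
    have := psd_xyz hp 1 t 1
    rw [h] at this
    linarith
  subst ep
  have key : ∀ y z, 0 ≤ a * y ^ 2 + b * y * z + c * z ^ 2 ∧
      (z * (q * y ^ 2 + r * y * z + s * z ^ 2)) ^ 2 ≤ 4 * (a * y ^ 2 + b * y * z + c * z ^ 2) *
        (z ^ 2 * (k2 * y ^ 2 + k3 * y * z + k4 * z ^ 2)) := by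
    intro y z
    have := quad_nonneg (a := a * y ^ 2 + b * y * z + c * z ^ 2)
      (b := z * (q * y ^ 2 + r * y * z + s * z ^ 2))
      (c := z ^ 2 * (k2 * y ^ 2 + k3 * y * z + k4 * z ^ 2))
      fun t => by
        have := psd_xyz hp t y z
        rw [h] at this
        linarith
    exact ⟨this.1, this.2.2⟩
  by_cases hpos : ∀ y z, (y ≠ 0 ∨ z ≠ 0) → 0 < a * y ^ 2 + b * y * z + c * z ^ 2
  swap
  · push Not at hpos
    obtain ⟨β, γ, hβγ, hle⟩ := hpos
    have hz0 := le_antisymm hle (key β γ).1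
    refine LBw hF hp hne h1 β γ hβγ (γ * (q * β ^ 2 + r * β * γ + s * γ ^ 2))
      (γ ^ 2 * (k2 * β ^ 2 + k3 * β * γ + k4 * γ ^ 2)) fun x => ?_
    rw [h]
    linear_combination x ^ 2 * hz0
  have ha : 0 < a := by have := hpos 1 0 (by simp); linarith
  have hc : 0 < c := by have := hpos 0 1 (by simp); linarith
  have disc : ∀ y z, 0 ≤ 4 * (a * y ^ 2 + b * y * z + c * z ^ 2) *
      (k2 * y ^ 2 + k3 * y * z + k4 * z ^ 2) - (q * y ^ 2 + r * y * z + s * z ^ 2) ^ 2 := by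
    intro y
    have d0 : ∀ z, z ≠ 0 → 0 ≤ 4 * (a * y ^ 2 + b * y * z + c * z ^ 2) *
      (k2 * y ^ 2 + k3 * y * z + k4 * z ^ 2) - (q * y ^ 2 + r * y * z + s * z ^ 2) ^ 2 := by
      intro z hz
      have := (key y z).2
      have hz2 : 0 < z ^ 2 := by positivity
      refine nonneg_of_mul_nonneg_right (a := z ^ 2) ?_ hz2
      linarith
    intro z
    by_cases hz : z = 0
    · subst hz
      exact nonneg_of_punct (φ := fun z => 4 * (a * y ^ 2 + b * y * z + c * z ^ 2) *
        (k2 * y ^ 2 + k3 * y * z + k4 * z ^ 2) - (q * y ^ 2 + r * y * z + s * z ^ 2) ^ 2)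
        (by fun_prop) d0
    · exact d0 z hz
  by_cases hD : ∀ y z, (y ≠ 0 ∨ z ≠ 0) → 0 < 4 * (a * y ^ 2 + b * y * z + c * z ^ 2) *
      (k2 * y ^ 2 + k3 * y * z + k4 * z ^ 2) - (q * y ^ 2 + r * y * z + s * z ^ 2) ^ 2
  · obtain ⟨ε, hε, hb⟩ := circle_bound (fun y z => 4 * (a * y ^ 2 + b * y * z + c * z ^ 2) *
      (k2 * y ^ 2 + k3 * y * z + k4 * z ^ 2) - (q * y ^ 2 + r * y * z + s * z ^ 2) ^ 2) 2
      (by fun_prop) (fun t y z => by ring) hD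
    refine QB_explicit (ε / (4 * (a + c))) (by positivity) 0 0 1 0 0 0 ⟨0, 0, 1, by norm_num⟩ ?_
    intro x y z
    have hFn := psd_xyz hp x y z
    by_cases hyz : y ≠ 0 ∨ z ≠ 0
    · have hR : 0 < y ^ 2 + z ^ 2 := by rcases hyz with hy | hz <;> positivity
      have t1 := hb y z hyz
      have t2 := trace_bound (fun y z => (key y z).1) y z
      have t3 := mul_le_mul_of_nonneg_right t2 hFn
      have t4 : z ^ 2 * (ε * (y ^ 2 + z ^ 2) ^ 2) ≤
          4 * ((a * y ^ 2 + b * y * z + c * z ^ 2) * eval ![x, y, z] F) := by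
        have t5 := mul_le_mul_of_nonneg_left t1 (sq_nonneg z)
        rw [h]
        have t6 := sq_nonneg (2 * x * (a * y ^ 2 + b * y * z + c * z ^ 2)
          + z * (q * y ^ 2 + r * y * z + s * z ^ 2))
        linarith
      have t7 : (y ^ 2 + z ^ 2) * (ε * z ^ 2 * (y ^ 2 + z ^ 2)) ≤
          (y ^ 2 + z ^ 2) * (4 * (a + c) * eval ![x, y, z] F) := by linarith
      have t8 := le_of_mul_le_mul_left t7 hR
      rw [div_mul_eq_mul_div, div_le_iff₀ (by positivity)]
      have t9 : 0 ≤ ε * z ^ 2 * y ^ 2 := by positivity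
      linarith
    · push Not at hyz
      rw [hyz.2]
      rw [hyz.2] at hFn
      linarith
  · push Not at hD
    obtain ⟨β, γ, hβγ, hle⟩ := hD
    have hz0 := le_antisymm hle (disc β γ)
    have hf0 := hpos β γ hβγ
    obtain ⟨α, hα⟩ : ∃ α, (q * β ^ 2 + r * β * γ + s * γ ^ 2)
        + 2 * α * (a * β ^ 2 + b * β * γ + c * γ ^ 2) = 0 :=
      ex_root hf0.ne'
    have hid : ∀ y z, 4 * (a * y ^ 2 + b * y * z + c * z ^ 2) *
        ((k2 + α * q + α ^ 2 * a) * y ^ 2 + (k3 + α * r + α ^ 2 * b) * y * z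
          + (k4 + α * s + α ^ 2 * c) * z ^ 2) =
        (4 * (a * y ^ 2 + b * y * z + c * z ^ 2) *
      (k2 * y ^ 2 + k3 * y * z + k4 * z ^ 2) - (q * y ^ 2 + r * y * z + s * z ^ 2) ^ 2)
        + ((q + 2 * α * a) * y ^ 2 + (r + 2 * α * b) * y * z + (s + 2 * α * c) * z ^ 2) ^ 2 := by
      intro y z; ring
    have hg' : (q + 2 * α * a) * β ^ 2 + (r + 2 * α * b) * β * γ + (s + 2 * α * c) * γ ^ 2 = 0 := by
      linear_combination hα
    have hk' : (k2 + α * q + α ^ 2 * a) * β ^ 2 + (k3 + α * r + α ^ 2 * b) * β * γ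
          + (k4 + α * s + α ^ 2 * c) * γ ^ 2 = 0 := by
      have := hid β γ
      rw [hz0, hg'] at this
      have h4 : (4 * (a * β ^ 2 + b * β * γ + c * γ ^ 2)) ≠ 0 := by positivity
      exact (mul_eq_zero.1 (this.trans (by ring))).resolve_left h4
    have hkp : ∀ y z, 0 ≤ (k2 + α * q + α ^ 2 * a) * y ^ 2 + (k3 + α * r + α ^ 2 * b) * y * z
          + (k4 + α * s + α ^ 2 * c) * z ^ 2 := by
      intro y z
      by_cases hyz : y ≠ 0 ∨ z ≠ 0
      · have := hpos y z hyz
        refine nonneg_of_mul_nonneg_right (a := 4 * (a * y ^ 2 + b * y * z + c * z ^ 2)) ?_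
          (by positivity)
        rw [hid]
        have := disc y z
        positivity
      · push Not at hyz
        rw [hyz.1, hyz.2]; norm_num
    obtain ⟨m1, m2, hm⟩ := BL hβγ hg'
    obtain ⟨μ, hμ, hl⟩ := BQ hβγ hk' hkp
    have hFe : ∀ x y z, eval ![x, y, z] F = (x - α * z) ^ 2 * (a * y ^ 2 + b * y * z + c * z ^ 2)
        + (x - α * z) * (z * ((γ * y - β * z) * (m1 * y + m2 * z)))
        + z ^ 2 * (μ * (γ * y - β * z) ^ 2) := by
      intro x y z
      rw [h, ← hm, ← hl]; ring
    have hdisc : ∀ y z, 0 ≤ (γ * y - β * z) ^ 2 * (4 * (a * y ^ 2 + b * y * z + c * z ^ 2) * μ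
        - (m1 * y + m2 * z) ^ 2) := by
      intro y z
      have t1 := hid y z
      have t2 := disc y z
      rw [hl, hm] at t1
      linarith
    have hβγ2 : 0 < γ ^ 2 + β ^ 2 := by rcases hβγ with hy | hz <;> positivity
    have hdisc' : ∀ y z, 0 ≤ 4 * (a * y ^ 2 + b * y * z + c * z ^ 2) * μ
        - (m1 * y + m2 * z) ^ 2 := by
      intro y z
      by_cases hlz : γ * y - β * z = 0
      · have := nonneg_of_punct (φ := fun t => 4 * (a * (y + t * γ) ^ 2 + b * (y + t * γ) * (z - t * β)
          + c * (z - t * β) ^ 2) * μ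
          - (m1 * (y + t * γ) + m2 * (z - t * β)) ^ 2) (by fun_prop) (fun t ht => by
            have := hdisc (y + t * γ) (z - t * β)
            refine nonneg_of_mul_nonneg_right this ?_
            have e : γ * (y + t * γ) - β * (z - t * β) = t * (γ ^ 2 + β ^ 2) := by
              linear_combination hlz
            rw [e]; positivity)
        simpa using this
      · exact nonneg_of_mul_nonneg_right (hdisc y z) (by positivity)
    rcases hμ.lt_or_eq with hμ | hμ
    · refine QB_explicit (1 / (4 * μ)) (by positivity) 0 0 (-2 * μ * β - α * m2) m1 m2
        (2 * μ * γ - α * m1) ?_ ?_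
      · by_contra hcon
        push Not at hcon
        have t1 := hcon 1 1 0
        have t2 := hcon 1 0 1
        have t3 := hcon 0 0 1
        have t4 := hcon 0 1 1
        have e1 : m1 = 0 := by linarith
        have e2 : m2 = 0 := by linarith
        subst e1 e2
        have e3 : μ * β = 0 := by linarith
        have e4 : μ * γ = 0 := by linarith
        rcases hβγ with hb | hg
        · exact (mul_ne_zero hμ.ne' hb) e3
        · exact (mul_ne_zero hμ.ne' hg) e4
      · intro x y z
        rw [hFe, div_mul_eq_mul_div, div_le_iff₀ (by positivity)]
        have := mul_nonneg (sq_nonneg (x - α * z)) (hdisc' y z)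
        linarith
    · subst hμ
      have hm0 : ∀ y z, m1 * y + m2 * z = 0 := by
        intro y z
        have := hdisc' y z
        nlinarith
      refine QB_explicit (1 / (4 * a)) (by positivity) 0 0 (-α * b) (2 * a) b (-2 * a * α)
        ⟨1, 1, 0, ?_⟩ ?_
      · intro hcon
        linarith
      · intro x y z
        rw [hFe, hm0, div_mul_eq_mul_div, div_le_iff₀ (by positivity)]
        have t1 := (quad_nonneg (a := a) (b := b) (c := c) fun t => by
          have := (key t 1).1; linarith).2.2
        have := mul_nonneg (sub_nonneg.2 t1) (sq_nonneg ((x - α * z) * z))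
        linarith

lemma L1 {F : Pol} (hF : F.IsHomogeneous 4) (hp : Psd F) (hne : F ≠ 0)
    (h1 : eval ![1, 0, 0] F = 0) : QB 2 F := by
  obtain ⟨a, b, c, p, q, r, s, k0, k1, k2, k3, k4, h⟩ := rep_e1 hF hp h1
  have key : ∀ y z, 0 ≤ a * y ^ 2 + b * y * z + c * z ^ 2 ∧
      (p * y ^ 3 + q * y ^ 2 * z + r * y * z ^ 2 + s * z ^ 3) ^ 2 ≤
        4 * (a * y ^ 2 + b * y * z + c * z ^ 2) *
        (k0 * y ^ 4 + k1 * y ^ 3 * z + k2 * y ^ 2 * z ^ 2 + k3 * y * z ^ 3 + k4 * z ^ 4) := by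
    intro y z
    have := quad_nonneg (a := a * y ^ 2 + b * y * z + c * z ^ 2)
      (b := p * y ^ 3 + q * y ^ 2 * z + r * y * z ^ 2 + s * z ^ 3)
      (c := k0 * y ^ 4 + k1 * y ^ 3 * z + k2 * y ^ 2 * z ^ 2 + k3 * y * z ^ 3 + k4 * z ^ 4)
      fun t => by
        have := psd_xyz hp t y z
        rw [h] at this
        linarith
    exact ⟨this.1, this.2.2⟩
  by_cases hpos : ∀ y z, (y ≠ 0 ∨ z ≠ 0) → 0 < a * y ^ 2 + b * y * z + c * z ^ 2
  swap
  · push Not at hpos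
    obtain ⟨β, γ, hβγ, hle⟩ := hpos
    have hz0 := le_antisymm hle (key β γ).1
    refine LBw hF hp hne h1 β γ hβγ (p * β ^ 3 + q * β ^ 2 * γ + r * β * γ ^ 2 + s * γ ^ 3)
      (k0 * β ^ 4 + k1 * β ^ 3 * γ + k2 * β ^ 2 * γ ^ 2 + k3 * β * γ ^ 3 + k4 * γ ^ 4) fun x => ?_
    rw [h]
    linear_combination x ^ 2 * hz0
  have ha : 0 < a := by have := hpos 1 0 (by simp); linarith
  have hc : 0 < c := by have := hpos 0 1 (by simp); linarith
  by_cases hD : ∀ y z, (y ≠ 0 ∨ z ≠ 0) → 0 < 4 * (a * y ^ 2 + b * y * z + c * z ^ 2) *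
        (k0 * y ^ 4 + k1 * y ^ 3 * z + k2 * y ^ 2 * z ^ 2 + k3 * y * z ^ 3 + k4 * z ^ 4)
        - (p * y ^ 3 + q * y ^ 2 * z + r * y * z ^ 2 + s * z ^ 3) ^ 2
  · obtain ⟨ε, hε, hb⟩ := circle_bound (fun y z => 4 * (a * y ^ 2 + b * y * z + c * z ^ 2) *
        (k0 * y ^ 4 + k1 * y ^ 3 * z + k2 * y ^ 2 * z ^ 2 + k3 * y * z ^ 3 + k4 * z ^ 4)
        - (p * y ^ 3 + q * y ^ 2 * z + r * y * z ^ 2 + s * z ^ 3) ^ 2) 3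
      (by fun_prop) (fun t y z => by ring) hD
    refine QB_explicit (ε / (4 * (a + c))) (by positivity) 0 1 1 0 0 0 ⟨0, 0, 1, by norm_num⟩ ?_
    intro x y z
    have hFn := psd_xyz hp x y z
    by_cases hyz : y ≠ 0 ∨ z ≠ 0
    · have hR : 0 < y ^ 2 + z ^ 2 := by rcases hyz with hy | hz <;> positivity
      have t1 := hb y z hyz
      have t2 := trace_bound (fun y z => (key y z).1) y z
      have t3 := mul_le_mul_of_nonneg_right t2 hFn
      have t4 : ε * (y ^ 2 + z ^ 2) ^ 3 ≤
          4 * ((a * y ^ 2 + b * y * z + c * z ^ 2) * eval ![x, y, z] F) := by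
        rw [h]
        have t6 := sq_nonneg (2 * x * (a * y ^ 2 + b * y * z + c * z ^ 2)
          + (p * y ^ 3 + q * y ^ 2 * z + r * y * z ^ 2 + s * z ^ 3))
        linarith
      have t7 : (y ^ 2 + z ^ 2) * (ε * (y ^ 2 + z ^ 2) ^ 2) ≤
          (y ^ 2 + z ^ 2) * (4 * (a + c) * eval ![x, y, z] F) := by linarith
      have t8 := le_of_mul_le_mul_left t7 hR
      rw [div_mul_eq_mul_div, div_le_iff₀ (by positivity)]
      linarith
    · push Not at hyz
      rw [hyz.1, hyz.2]
      rw [hyz.1, hyz.2] at hFn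
      linarith
  · push Not at hD
    obtain ⟨β, γ, hβγ, hle⟩ := hD
    have hz0 := le_antisymm hle (sub_nonneg.2 (key β γ).2)
    have hf0 := hpos β γ hβγ
    obtain ⟨α, hα⟩ : ∃ α, (p * β ^ 3 + q * β ^ 2 * γ + r * β * γ ^ 2 + s * γ ^ 3)
        + 2 * α * (a * β ^ 2 + b * β * γ + c * γ ^ 2) = 0 :=
      ex_root hf0.ne'
    have hv : eval ![α, β, γ] F = 0 := by
      have h4 : (4 * (a * β ^ 2 + b * β * γ + c * γ ^ 2)) ≠ 0 := by positivity
      refine (mul_eq_zero.1 (?_ : (4 * (a * β ^ 2 + b * β * γ + c * γ ^ 2)) * _ = 0)).resolve_left h4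
      rw [h]
      linear_combination hz0 + ((p * β ^ 3 + q * β ^ 2 * γ + r * β * γ ^ 2 + s * γ ^ 3)
        + 2 * α * (a * β ^ 2 + b * β * γ + c * γ ^ 2)) * hα
    have hcr : crossProduct ![(1 : ℝ), 0, 0] ![α, β, γ] ≠ 0 := by
      rw [cross_apply]; intro h0
      have e1 := congrFun h0 1
      have e2 := congrFun h0 2
      simp at e1 e2
      tauto
    obtain ⟨F', hF', hne', hp', hQ, he⟩ := change (k := 2) hF _ _ hcr
    refine hQ (L2 hF' (hp' hp) (hne' hne) ?_ ?_)
    · rw [he]; refine Eq.trans ?_ h1; congr 2; ext i; fin_cases i <;> simp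
    · rw [he]; refine Eq.trans ?_ hv; congr 2; ext i; fin_cases i <;> simp

lemma ex_cross {p : Fin 3 → ℝ} (hp : p ≠ 0) : ∃ v, crossProduct p v ≠ 0 := by
  by_contra h
  push Not at h
  apply hp
  have a := h ![1, 0, 0]
  have b := h ![0, 1, 0]
  rw [cross_apply] at a b
  have a1 := congrFun a 1
  have a2 := congrFun a 2
  have b2 := congrFun b 2
  simp at a1 a2 b2
  ext i; fin_cases i <;> simp [*]

lemma QB_quartic {F : Pol} (hF : F.IsHomogeneous 4) (hp : Psd F) (hne : F ≠ 0) : QB 2 F := by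
  by_cases h : ∀ u : Fin 3 → ℝ, u ≠ 0 → 0 < eval u F
  · obtain ⟨ε, hε, hb⟩ := sphere_bound (k := 2) hF h
    refine QB_explicit ε hε 1 1 1 0 0 0 ⟨1, 0, 0, by norm_num⟩ fun x y z => ?_
    have := hb x y z
    linarith
  · push Not at h
    obtain ⟨u, hu, hle⟩ := h
    have h0 := le_antisymm hle (hp u)
    obtain ⟨v, hv⟩ := ex_cross hu
    obtain ⟨F', hF', hne', hp', hQ, he⟩ := change (k := 2) hF _ _ hv
    refine hQ (L1 hF' (hp' hp) (hne' hne) ?_)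
    rw [he]; refine Eq.trans ?_ h0; congr 2; ext i; simp

lemma QB_lin {F : Pol} (κ : ℝ) (hκ : 0 < κ) (A B D : ℝ)
    (hne : ¬ (A = 0 ∧ B = 0 ∧ D = 0))
    (h : ∀ x y z : ℝ, κ * (A * x + B * y + D * z) ^ 2 ≤ eval ![x, y, z] F) : QB 1 F := by
  have he : ∀ x y z : ℝ, eval ![x, y, z] (lin ![A, B, D]) = A * x + B * y + D * z := by
    intro x y z; rw [eval_lin]; simp [dotProduct, Fin.sum_univ_three]
  refine ⟨C (Real.sqrt κ) * lin ![A, B, D], (lin_hom _).C_mul _, ?_, ?_⟩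
  · refine mul_ne_zero ?_ ?_
    · rw [Ne, C_eq_zero]; exact (Real.sqrt_pos.2 hκ).ne'
    · intro h0
      apply hne
      have t1 := he 1 0 0
      have t2 := he 0 1 0
      have t3 := he 0 0 1
      rw [h0, map_zero] at t1 t2 t3
      exact ⟨by linarith, by linarith, by linarith⟩
  · intro u
    rw [vec3 u]
    have := h (u 0) (u 1) (u 2)
    rw [map_sub, map_pow, map_mul, eval_C, mul_pow, Real.sq_sqrt hκ.le, he]
    linarith

lemma QB_quadric {F : Pol} (hF : F.IsHomogeneous 2) (hp : Psd F) (hne : F ≠ 0) : QB 1 F := by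
  obtain ⟨a, b, c, d, e, f, h⟩ := rep2 hF
  have k1 : ∀ y z, 0 ≤ a ∧ 0 ≤ b * y ^ 2 + c * z ^ 2 + f * y * z ∧
      (d * y + e * z) ^ 2 ≤ 4 * a * (b * y ^ 2 + c * z ^ 2 + f * y * z) := fun y z =>
    quad_nonneg fun t => by
      have := psd_xyz hp t y z
      rw [h] at this
      linarith
  rcases (k1 0 0).1.lt_or_eq with ha | ha
  · refine QB_lin (1 / (4 * a)) (by positivity) (2 * a) d e ?_ ?_
    · rintro ⟨h0, -⟩; linarith
    · intro x y z
      rw [h, div_mul_eq_mul_div, div_le_iff₀ (by positivity)]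
      have := (k1 y z).2.2
      linarith
  · subst ha
    have hd : d = 0 := by have := (k1 1 0).2.2; nlinarith
    have he : e = 0 := by have := (k1 0 1).2.2; nlinarith
    subst hd he
    obtain ⟨hb, hc, hf⟩ := quad_nonneg (a := b) (b := f) (c := c) fun t => by
      have := (k1 t 1).2.1; linarith
    rcases hb.lt_or_eq with hb | hb
    · refine QB_lin (1 / (4 * b)) (by positivity) 0 (2 * b) f ?_ ?_
      · rintro ⟨-, h0, -⟩; linarith
      · intro x y z
        rw [h, div_mul_eq_mul_div, div_le_iff₀ (by positivity)]
        have := mul_nonneg (sub_nonneg.2 hf) (sq_nonneg z)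
        linarith
    · subst hb
      have hf0 : f = 0 := by nlinarith
      subst hf0
      have hc0 : c ≠ 0 := by
        rintro rfl
        obtain ⟨x, y, z, hx⟩ := ex_ne hne
        apply hx; rw [h]; ring
      refine QB_lin c (lt_of_le_of_ne hc (Ne.symm hc0)) 0 0 1 (by simp) fun x y z => ?_
      rw [h]; linarith

/-- psd ternary forms of degree at most `4` are sums of squares -/
theorem hilbert {F : Pol} {n : ℕ} (hn : n ≤ 2) (hF : F.IsHomogeneous (n * 2)) (hp : Psd F) :
    Sos F := by
  interval_cases n
  · obtain ⟨a, ha⟩ := rep0 (F := F) (by simpa using hF)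
    have h0 : 0 ≤ a := by rw [← ha 0 0 0]; exact hp _
    refine ⟨1, fun _ => C (Real.sqrt a), ?_⟩
    apply MvPolynomial.funext
    intro u
    rw [vec3 u, ha]
    simp [Real.sq_sqrt h0]
  · exact sos_of_sqBelow 1 (fun F h1 h2 h3 => QB_quadric h1 h2 h3) F hF hp
  · exact sos_of_sqBelow 2 (fun F h1 h2 h3 => QB_quartic h1 h2 h3) F hF hp

lemma vanish_mk {F : Pol} {n : ℕ} (hF : F.IsHomogeneous n) {p : Fin 3 → ℝ} (hp : p ≠ 0)
    (h : eval p F = 0) : VanishAt F (Projectivization.mk ℝ p hp) := by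
  obtain ⟨a, ha⟩ := Projectivization.exists_smul_eq_mk_rep ℝ p hp
  unfold VanishAt
  rw [← ha]
  have : a • p = (a : ℝ) • p := rfl
  rw [this, eval_smul_hom hF, h, mul_zero]

/-- on a segment from `A > 0` to `A < 0` there is a common zero of `A` and `B` -/
lemma seg_zero {A B : Pol} (hA0 : A ≠ 0) (hp : Psd (A * B)) {u w : Fin 3 → ℝ}
    (hu : 0 < eval u A) (hw : eval w A < 0) :
    ∃ t : ℝ, eval ((1 - t) • u + t • w) A = 0 ∧ eval ((1 - t) • u + t • w) B = 0 := by
  have hconn : IsPreconnected (segment ℝ u w) := (convex_segment u w).isPreconnected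
  rw [isPreconnected_closed_iff] at hconn
  have hpos : closure {x | 0 < eval x A} ⊆ {x | 0 ≤ eval x A ∧ 0 ≤ eval x B} := by
    apply closure_minimal
    · intro x hx
      have hx' : 0 < eval x A := hx
      have h1 := hp x
      rw [map_mul] at h1
      exact ⟨hx'.le, nonneg_of_mul_nonneg_right h1 hx'⟩
    · exact (isClosed_le continuous_const (cont_eval A)).inter
        (isClosed_le continuous_const (cont_eval B))
  have hneg : closure {x | eval x A < 0} ⊆ {x | eval x A ≤ 0 ∧ eval x B ≤ 0} := by
    apply closure_minimal
    · intro x hx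
      have hx' : eval x A < 0 := hx
      have h1 := hp x
      rw [map_mul] at h1
      exact ⟨hx'.le, by nlinarith⟩
    · exact (isClosed_le (cont_eval A) continuous_const).inter
        (isClosed_le (cont_eval B) continuous_const)
  obtain ⟨x, hx, hx1, hx2⟩ := hconn (closure {x | 0 < eval x A}) (closure {x | eval x A < 0})
    isClosed_closure isClosed_closure (by
      rw [← closure_union]
      have : ({x | 0 < eval x A} ∪ {x | eval x A < 0}) = {x | eval x A ≠ 0} := by
        ext x
        simp only [Set.mem_union, Set.mem_ofPred_eq]
        constructor
        · rintro (h | h)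
          · exact h.ne'
          · exact h.ne
        · intro h
          exact (lt_or_gt_of_ne h).symm
      rw [this, (dense_ne hA0).closure_eq]
      exact Set.subset_univ _)
    ⟨u, left_mem_segment ℝ u w, subset_closure hu⟩
    ⟨w, right_mem_segment ℝ u w, subset_closure hw⟩
  rw [segment_eq_image] at hx
  obtain ⟨t, -, rfl⟩ := hx
  have a1 := hpos hx1
  have a2 := hneg hx2
  exact ⟨t, le_antisymm a2.1 a1.1, le_antisymm a2.2 a1.2⟩

lemma many_zeros {A B : Pol} {m n : ℕ} (hA : A.IsHomogeneous m) (hB : B.IsHomogeneous n)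
    (hp : Psd (A * B)) {u w : Fin 3 → ℝ} (hu : 0 < eval u A) (hw : eval w A < 0) (N : ℕ) :
    ∃ T : Finset P2, T.card = N ∧ (∀ P ∈ T, VanishAt A P) ∧ ∀ P ∈ T, VanishAt B P := by
  classical
  have hA0 : A ≠ 0 := by rintro rfl; simp at hu
  have hu0 : u ≠ 0 := by
    rintro rfl
    have e : (0 : Fin 3 → ℝ) = (0 : ℝ) • w := by simp
    rw [e, eval_smul_hom hA] at hu
    rcases m with _ | m
    · simp at hu; linarith
    · simp at hu
  induction N with
  | zero => exact ⟨∅, by simp⟩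
  | succ N ih =>
    obtain ⟨T, hT, hTA, hTB⟩ := ih
    obtain ⟨v0, hv0⟩ := ex_cross hu0
    let Q : Pol := lin (crossProduct u v0) * ∏ P ∈ T, lin (crossProduct u P.rep)
    have hcr : ∀ P ∈ T, crossProduct u P.rep ≠ 0 := by
      intro P hP
      rw [crossProduct_ne_zero_iff_linearIndependent, LinearIndependent.pair_iff' hu0]
      intro a ha
      have h1 : eval P.rep A = 0 := hTA P hP
      rw [← ha, eval_smul_hom hA] at h1
      have h2 : a = 0 := by
        rcases mul_eq_zero.1 h1 with h | h
        · exact eq_zero_of_pow_eq_zero h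
        · exact absurd h hu.ne'
      apply P.rep_nonzero
      rw [← ha, h2, zero_smul]
    have hQ : Q ≠ 0 := by
      have hl : ∀ a, a ≠ 0 → lin a ≠ 0 := by
        intro a ha h0
        apply ha
        have := eval_lin a a
        rw [h0, map_zero] at this
        exact dotProduct_self_eq_zero.1 this.symm
      exact mul_ne_zero (hl _ hv0) (Finset.prod_ne_zero_iff.2 fun P hP => hl _ (hcr P hP))
    have hop : IsOpen {x | eval x A < 0} := isOpen_lt (cont_eval A) continuous_const
    obtain ⟨v, hv1, hv2⟩ := (dense_ne hQ).exists_mem_open hop ⟨w, hw⟩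
    obtain ⟨t, ht1, ht2⟩ := seg_zero hA0 hp hu hv2
    have hd : ∀ P ∈ T, crossProduct u P.rep ⬝ᵥ v ≠ 0 := by
      intro P hP h0
      apply hv1
      simp only [Q, map_mul, map_prod]
      refine mul_eq_zero_of_right _ ?_
      refine Finset.prod_eq_zero hP ?_
      rw [eval_lin, h0]
    have ht0 : t ≠ 0 := by
      rintro rfl
      simp at ht1
      linarith
    have hdp : ∀ P : P2, crossProduct u P.rep ⬝ᵥ ((1 - t) • u + t • v) =
        t * (crossProduct u P.rep ⬝ᵥ v) := by
      intro P
      rw [dotProduct_add, dotProduct_smul, dotProduct_smul, dotProduct_comm _ u, dot_self_cross]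
      simp
    by_cases hp0 : (1 - t) • u + t • v = 0
    · -- then v is proportional to u
      exfalso
      have hv3 : v = (-(1 - t) / t) • u := by
        have h3 : t • v = (-(1 - t)) • u := by
          rw [neg_smul]; exact (neg_eq_of_add_eq_zero_right hp0).symm
        rw [div_eq_inv_mul, mul_smul, ← h3, smul_smul, inv_mul_cancel₀ ht0, one_smul]
      apply hv1
      simp only [Q, map_mul]
      refine mul_eq_zero_of_left ?_ _
      rw [eval_lin, hv3, dotProduct_smul, dotProduct_comm, dot_self_cross, smul_zero]
    · refine ⟨insert (Projectivization.mk ℝ _ hp0) T, ?_, ?_, ?_⟩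
      · rw [Finset.card_insert_of_notMem, hT]
        intro hmem
        apply hd _ hmem
        obtain ⟨a, ha⟩ := Projectivization.exists_smul_eq_mk_rep ℝ _ hp0
        have ha' : (a : ℝ) • ((1 - t) • u + t • v) = (Projectivization.mk ℝ _ hp0).rep := ha
        have h1 := hdp (Projectivization.mk ℝ _ hp0)
        have h2 : crossProduct u (Projectivization.mk ℝ _ hp0).rep ⬝ᵥ
            (a : ℝ) • ((1 - t) • u + t • v) = 0 := by
          rw [ha', dotProduct_comm, dot_cross_self]
        rw [dotProduct_smul, h1] at h2
        have ha0 : (a : ℝ) ≠ 0 := a.ne_zero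
        simpa [ha0, ht0] using h2
      · intro P hP
        rcases Finset.mem_insert.1 hP with rfl | hP
        · exact vanish_mk hA hp0 ht1
        · exact hTA P hP
      · intro P hP
        rcases Finset.mem_insert.1 hP with rfl | hP
        · exact vanish_mk hB hp0 ht2
        · exact hTB P hP

/-- a reduced pair of factors whose product is psd: the first one does not change sign -/
lemma no_change {A B : Pol} {m n : ℕ} (hA : A.IsHomogeneous m) (hB : B.IsHomogeneous n)
    (hp : Psd (A * B)) (hrel : IsRelPrime A B) {u w : Fin 3 → ℝ} (hu : 0 < eval u A)
    (hw : eval w A < 0) : False := by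
  obtain ⟨T, hT, hTA, hTB⟩ := many_zeros hA hB hp hu hw (m * n + 1)
  have hA0 : A ≠ 0 := by rintro rfl; simp at hu
  have := bezout1 hA hB hA0 hrel T hTA hTB
  omega

lemma hom0_C {F : Pol} (hF : F.IsHomogeneous 0) : ∃ r : ℝ, F = C r := by
  rw [← totalDegree_zero_iff_isHomogeneous, totalDegree_eq_zero_iff_eq_C] at hF
  exact ⟨_, hF⟩

lemma reduce {A B : Pol} {m n : ℕ} (hA : A.IsHomogeneous m) (hB : B.IsHomogeneous n)
    (hA0 : A ≠ 0) (hB0 : B ≠ 0) :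
    ∃ (φ a b : Pol) (e i j : ℕ), φ.IsHomogeneous e ∧ a.IsHomogeneous i ∧ b.IsHomogeneous j ∧
      e + i = m ∧ e + j = n ∧ A = φ * a ∧ B = φ * b ∧ φ ≠ 0 ∧ a ≠ 0 ∧ b ≠ 0 ∧ IsRelPrime a b ∧
      (e = 0 → IsRelPrime A B) := by
  obtain ⟨a, b, φ, hrel, rfl, rfl⟩ := UniqueFactorizationMonoid.exists_reduced_factors A hA0 B
  obtain ⟨e, i, h1, h2, h3⟩ := hom_factor hA hA0
  obtain ⟨e', j, h1', h4, h5⟩ := hom_factor hB hB0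
  have hφ : φ ≠ 0 := left_ne_zero_of_mul hA0
  have ee := h1.inj_right h1' hφ
  subst ee
  refine ⟨φ, a, b, e, i, j, h1, h2, h4, h3, h5, rfl, rfl, hφ, right_ne_zero_of_mul hA0,
    right_ne_zero_of_mul hB0, hrel, ?_⟩
  rintro rfl
  obtain ⟨r, rfl⟩ := hom0_C h1
  have hr : r ≠ 0 := by rintro rfl; simp at hφ
  exact (isRelPrime_mul_unit_left ((isUnit_iff_ne_zero.2 hr).map C)).2 hrel

lemma sos_of_indef {A B : Pol} (hg : (A * B).IsHomogeneous 6) (hp : Psd (A * B))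
    {u w : Fin 3 → ℝ} (hu : 0 < eval u A) (hw : eval w A < 0) : Sos (A * B) := by
  by_cases h0 : A * B = 0
  · exact ⟨0, fun _ => 0, by simp [h0]⟩
  obtain ⟨m, n, hA, hB, hmn⟩ := hom_factor hg h0
  obtain ⟨φ, a, b, e, i, j, hφ, ha, hb, hei, hej, rfl, rfl, hφ0, ha0, hb0, hrel, -⟩ :=
    reduce hA hB (left_ne_zero_of_mul h0) (right_ne_zero_of_mul h0)
  have hab : φ * a * (φ * b) = φ ^ 2 * (a * b) := by ring
  rw [hab] at hp ⊢
  have hpab := psd_of_sq_mul hφ0 hp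
  have he : e ≠ 0 := by
    rintro rfl
    obtain ⟨r, rfl⟩ := hom0_C hφ
    simp only [map_mul, eval_C] at hu hw
    rcases lt_trichotomy r 0 with hr | hr | hr
    · exact no_change ha hb hpab hrel (u := w) (w := u) (pos_of_mul_neg_right hw hr.le)
        (neg_of_mul_pos_right hu hr.le)
    · subst hr; simp at hu
    · exact no_change ha hb hpab hrel (pos_of_mul_pos_right hu hr.le)
        (neg_of_mul_neg_right hw hr.le)
  have hh : (a * b).IsHomogeneous ((3 - e) * 2) := by
    have : (3 - e) * 2 = i + j := by omega
    rw [this]; exact ha.mul hb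
  obtain ⟨N, q, hq⟩ := hilbert (by omega) hh hpab
  refine ⟨N, fun k => φ * q k, ?_⟩
  rw [hq, Finset.mul_sum]
  exact Finset.sum_congr rfl fun k _ => by ring

lemma sos_of_odd {A g : Pol} {m : ℕ} (hg : g.IsHomogeneous 6) (hp : Psd g) (hA : A.IsHomogeneous m)
    (hm : Odd m) (hA0 : A ≠ 0) (hd : A ∣ g) : Sos g := by
  obtain ⟨B, rfl⟩ := hd
  obtain ⟨u, hu⟩ : ∃ u, eval u A ≠ 0 := by
    by_contra h
    push Not at h
    exact hA0 (MvPolynomial.funext fun u => by rw [h]; simp)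
  have hneg : eval ((-1 : ℝ) • u) A = - eval u A := by
    rw [eval_smul_hom hA, hm.neg_one_pow]; ring
  rcases lt_or_gt_of_ne hu with h | h
  · exact sos_of_indef hg hp (u := (-1 : ℝ) • u) (w := u) (by linarith) h
  · exact sos_of_indef hg hp (u := u) (w := (-1 : ℝ) • u) h (by linarith)

/-- the standing hypotheses -/
structure Setup (g : Pol) (S : Finset P2) : Prop where
  hom : g.IsHomogeneous 6
  psd : Psd g
  nsos : ¬ Sos g
  van : ∀ P ∈ S, VanishAt g P
  card : S.card = 9

lemma Setup.ne {g : Pol} {S : Finset P2} (h : Setup g S) : g ≠ 0 := by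
  rintro rfl
  exact h.nsos ⟨0, fun _ => 0, by simp⟩

lemma Setup.sing {g : Pol} {S : Finset P2} (h : Setup g S) : ∀ P ∈ S, SingAt g P :=
  fun P hP => ⟨h.van P hP, fun i => psd_sing h.psd (h.van P hP) i⟩

lemma line_bound {g : Pol} {S : Finset P2} (h : Setup g S) {l : Pol} (hl : l.IsHomogeneous 1)
    (hl0 : l ≠ 0) (T : Finset P2) (hTS : T ⊆ S) (hT : ∀ P ∈ T, VanishAt l P) : T.card ≤ 3 := by
  obtain ⟨φ, a, b, e, i, j, hφ, ha, hb, hei, hej, hA, hB, hφ0, ha0, hb0, hrel, he⟩ :=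
    reduce hl h.hom hl0 h.ne
  by_cases he0 : e = 0
  · have := (bezout2 hl h.hom hl0 (he he0) T hT (fun P hP => h.sing P (hTS hP))).1
    omega
  · have : e = 1 := by omega
    subst this
    exact absurd (sos_of_odd h.hom h.psd hφ odd_one hφ0 ⟨b, hB⟩) h.nsos

lemma conic_bound {g : Pol} {S : Finset P2} (h : Setup g S) {q : Pol} (hq : q.IsHomogeneous 2)
    (hq0 : q ≠ 0) (T : Finset P2) (hTS : T ⊆ S) (hT : ∀ P ∈ T, VanishAt q P) : T.card ≤ 6 := by
  obtain ⟨φ, a, b, e, i, j, hφ, ha, hb, hei, hej, hA, hB, hφ0, ha0, hb0, hrel, he⟩ :=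
    reduce hq h.hom hq0 h.ne
  by_cases he0 : e = 0
  · have := (bezout2 hq h.hom hq0 (he he0) T hT (fun P hP => h.sing P (hTS hP))).1
    omega
  by_cases he1 : e = 1
  · subst he1
    exact absurd (sos_of_odd h.hom h.psd hφ odd_one hφ0 ⟨b, hB⟩) h.nsos
  have he2 : e = 2 := by omega
  subst he2
  have hi : i = 0 := by omega
  subst hi
  obtain ⟨r, rfl⟩ := hom0_C ha
  have hr : r ≠ 0 := by rintro rfl; simp at ha0
  have hTφ : ∀ P ∈ T, eval P.rep φ = 0 := by
    intro P hP
    have h1 : eval P.rep q = 0 := hT P hP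
    rw [hA, map_mul, eval_C] at h1
    exact (mul_eq_zero.1 h1).resolve_right hr
  have hsemi : Psd φ ∨ Psd (-φ) := by
    by_contra hcon
    push Not at hcon
    obtain ⟨h1, h2⟩ := hcon
    unfold Psd at h1 h2
    push Not at h1 h2
    obtain ⟨w, hw⟩ := h1
    obtain ⟨u, hu⟩ := h2
    rw [map_neg] at hu
    apply h.nsos
    have hg := h.hom
    have hp := h.psd
    rw [hB] at hg hp ⊢
    exact sos_of_indef hg hp (by linarith : 0 < eval u φ) hw
  have hgr : ∀ P ∈ T, ∀ i, eval P.rep (pderiv i φ) = 0 := by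
    intro P hP i
    rcases hsemi with h1 | h1
    · exact psd_sing h1 (hTφ P hP) i
    · have := psd_sing h1 (by rw [map_neg, hTφ P hP, neg_zero]) i
      simpa using this
  obtain ⟨i, hi⟩ : ∃ i, pderiv i φ ≠ 0 := by
    by_contra hcon
    push Not at hcon
    apply hφ0
    apply MvPolynomial.funext
    intro u
    have := grad_euler hφ u
    have h0 : grad φ u = 0 := by ext i; simp [grad, hcon i]
    rw [h0, dotProduct_zero] at this
    simp at this
    simp [this]
  have := line_bound h (hφ.pderiv (i := i)) hi T hTS (fun P hP => hgr P hP i)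
  omega

/-- at most `3e` points of `S` on a curve of degree `e ≤ 3` -/
lemma curve_bound {g : Pol} {S : Finset P2} (h : Setup g S) {φ : Pol} {e : ℕ} (he : e ≤ 3)
    (hφ : φ.IsHomogeneous e) (hφ0 : φ ≠ 0) (T : Finset P2) (hTS : T ⊆ S)
    (hT : ∀ P ∈ T, VanishAt φ P) : T.card ≤ 3 * e := by
  interval_cases e
  · obtain ⟨r, rfl⟩ := hom0_C hφ
    have hr : r ≠ 0 := by rintro rfl; simp at hφ0
    rcases T.eq_empty_or_nonempty with rfl | ⟨P, hP⟩
    · simp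
    · have := hT P hP
      unfold VanishAt at this
      simp at this
      exact absurd this hr
  · exact line_bound h hφ hφ0 T hTS hT
  · exact conic_bound h hφ hφ0 T hTS hT
  · have := Finset.card_le_card hTS
    rw [h.card] at this
    exact this

lemma off_curve {g : Pol} {S : Finset P2} (h : Setup g S) {φ : Pol} {e : ℕ} (he : e ≤ 3)
    (hφ : φ.IsHomogeneous e) (hφ0 : φ ≠ 0) :
    ∃ T : Finset P2, T ⊆ S ∧ 9 ≤ T.card + 3 * e ∧ ∀ P ∈ T, eval P.rep φ ≠ 0 := by
  classical
  refine ⟨S.filter fun P => ¬ VanishAt φ P, Finset.filter_subset _ _, ?_, ?_⟩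
  · have h1 := Finset.card_filter_add_card_filter_not (s := S) (fun P => VanishAt φ P)
    have h2 := curve_bound h he hφ hφ0 (S.filter fun P => VanishAt φ P) (Finset.filter_subset _ _)
      (fun P hP => (Finset.mem_filter.1 hP).2)
    rw [h.card] at h1
    omega
  · intro P hP
    exact (Finset.mem_filter.1 hP).2

lemma dvd_of_top {f φ a b k : Pol} {i : ℕ} (ha : a.IsHomogeneous i) (hi : i = 0) (ha0 : a ≠ 0)
    (hf : f = φ * a) (hk : k = φ * b) : f ∣ k := by
  subst hi
  obtain ⟨r, rfl⟩ := hom0_C ha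
  have hr : r ≠ 0 := by rintro rfl; simp at ha0
  refine ⟨C r⁻¹ * b, ?_⟩
  rw [hf, hk]
  have : C r * C r⁻¹ = (1 : Pol) := by rw [← C_mul, mul_inv_cancel₀ hr, C_1]
  linear_combination -φ * b * this

lemma dich2 {g : Pol} {S : Finset P2} (h : Setup g S) {f k : Pol} (hf : f.IsHomogeneous 3)
    (hf0 : f ≠ 0) (hfS : ∀ P ∈ S, VanishAt f P) (hk : k.IsHomogeneous 6)
    (hkS : ∀ P ∈ S, SingAt k P) : f ∣ k ∨ IsRelPrime f k := by
  by_cases hk0 : k = 0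
  · left; rw [hk0]; exact dvd_zero f
  obtain ⟨φ, a, b, e, i, j, hφ, ha, hb, hei, hej, hA, hB, hφ0, ha0, hb0, hrel, he⟩ :=
    reduce hf hk hf0 hk0
  obtain ⟨T, hTS, hTc, hTφ⟩ := off_curve h (by omega : e ≤ 3) hφ hφ0
  have h1 := (bezout2 ha hb ha0 hrel T (fun P hP => by
      have h1 : eval P.rep f = 0 := hfS P (hTS hP)
      rw [hA, map_mul] at h1
      exact (mul_eq_zero.1 h1).resolve_left (hTφ P hP))
    (fun P hP => by
      obtain ⟨h1, h2⟩ := hkS P (hTS hP)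
      rw [hB, map_mul] at h1
      have h3 := (mul_eq_zero.1 h1).resolve_left (hTφ P hP)
      refine ⟨h3, fun i => ?_⟩
      have h4 := h2 i
      have h5 := congrFun (grad_mul φ b P.rep) i
      simp only [grad, Pi.add_apply, Pi.smul_apply, smul_eq_mul] at h5
      rw [← hB, h4, h3, zero_mul, add_zero] at h5
      exact (mul_eq_zero.1 h5.symm).resolve_left (hTφ P hP))).1
  have : e = 0 ∨ e = 3 := by
    have : e ≤ 3 := by omega
    obtain rfl : i = 3 - e := by omega
    obtain rfl : j = 6 - e := by omega
    interval_cases e <;> omega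
  rcases this with h0 | h3
  · right; exact he h0
  · left; exact dvd_of_top ha (by omega) ha0 hA hB

lemma dich1 {g : Pol} {S : Finset P2} (h : Setup g S) {f k : Pol} (hf : f.IsHomogeneous 3)
    (hf0 : f ≠ 0) (hfS : ∀ P ∈ S, VanishAt f P) (hk : k.IsHomogeneous 3)
    (hkS : ∀ P ∈ S, VanishAt k P) : f ∣ k ∨ IsRelPrime f k := by
  by_cases hk0 : k = 0
  · left; rw [hk0]; exact dvd_zero f
  obtain ⟨φ, a, b, e, i, j, hφ, ha, hb, hei, hej, hA, hB, hφ0, ha0, hb0, hrel, he⟩ :=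
    reduce hf hk hf0 hk0
  obtain ⟨T, hTS, hTc, hTφ⟩ := off_curve h (by omega : e ≤ 3) hφ hφ0
  have h1 := bezout1 ha hb ha0 hrel T (fun P hP => by
      have h1 : eval P.rep f = 0 := hfS P (hTS hP)
      rw [hA, map_mul] at h1
      exact (mul_eq_zero.1 h1).resolve_left (hTφ P hP))
    (fun P hP => by
      have h1 : eval P.rep k = 0 := hkS P (hTS hP)
      rw [hB, map_mul] at h1
      exact (mul_eq_zero.1 h1).resolve_left (hTφ P hP))
  have : e = 0 ∨ e = 3 := by
    have : e ≤ 3 := by omega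
    obtain rfl : i = 3 - e := by omega
    obtain rfl : j = 3 - e := by omega
    interval_cases e <;> omega
  rcases this with h0 | h3
  · right; exact he h0
  · left; exact dvd_of_top ha (by omega) ha0 hA hB

lemma dvd2 {g : Pol} {S : Finset P2} (h : Setup g S) {f k : Pol} (hf : f.IsHomogeneous 3)
    (hf0 : f ≠ 0) (hfS : ∀ P ∈ S, VanishAt f P) (hk : k.IsHomogeneous 6)
    (hkS : ∀ P ∈ S, SingAt k P) {P : P2} (hP : P ∉ S) (h1 : VanishAt f P) (h2 : VanishAt k P) :
    f ∣ k := by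
  rcases dich2 h hf hf0 hfS hk hkS with hd | hr
  · exact hd
  · have := (bezout2 hf hk hf0 hr S hfS hkS).2.1 P hP h1 h2
    rw [h.card] at this
    omega

lemma dvd1 {g : Pol} {S : Finset P2} (h : Setup g S) {f k : Pol} (hf : f.IsHomogeneous 3)
    (hf0 : f ≠ 0) (hfS : ∀ P ∈ S, VanishAt f P) (hk : k.IsHomogeneous 3)
    (hkS : ∀ P ∈ S, VanishAt k P) {P : P2} (hP : P ∉ S) (h1 : VanishAt f P) (h2 : VanishAt k P) :
    f ∣ k := by
  classical
  rcases dich1 h hf hf0 hfS hk hkS with hd | hr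
  · exact hd
  · have := bezout1 hf hk hf0 hr (insert P S)
      (fun Q hQ => by rcases Finset.mem_insert.1 hQ with rfl | hQ; exacts [h1, hfS Q hQ])
      (fun Q hQ => by rcases Finset.mem_insert.1 hQ with rfl | hQ; exacts [h2, hkS Q hQ])
    rw [Finset.card_insert_of_notMem hP, h.card] at this
    omega

lemma relprime_fg {g : Pol} {S : Finset P2} (h : Setup g S) {f : Pol} (hf : f.IsHomogeneous 3)
    (hf0 : f ≠ 0) (hfS : ∀ P ∈ S, VanishAt f P) : IsRelPrime f g := by
  rcases dich2 h hf hf0 hfS h.hom h.sing with hd | hr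
  · exact absurd (sos_of_odd h.hom h.psd hf (by decide) hf0 hd) h.nsos
  · exact hr

/-- a cubic has a real zero outside of any finite set -/
lemma extra_zero {f : Pol} (hf : f.IsHomogeneous 3) (S : Finset P2) : ∃ P ∉ S, VanishAt f P := by
  have hl : ∀ a, a ≠ 0 → lin a ≠ 0 := by
    intro a ha h0
    apply ha
    have := eval_lin a a
    rw [h0, map_zero] at this
    exact dotProduct_self_eq_zero.1 this.symm
  have hQ : (lin ![1, 0, 0] * ∏ P ∈ S, lin P.rep) ≠ 0 := by
    refine mul_ne_zero (hl _ ?_) (Finset.prod_ne_zero_iff.2 fun P _ => hl _ P.rep_nonzero)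
    intro h0
    have := congrFun h0 0
    simp at this
  obtain ⟨a, ha⟩ := (dense_ne hQ).nonempty
  have ha' : eval a (lin ![1, 0, 0] * ∏ P ∈ S, lin P.rep) ≠ 0 := ha
  rw [map_mul, map_prod] at ha'
  have ha0 : a ≠ 0 := by
    rintro rfl
    rw [eval_lin] at ha'
    simp at ha'
  have haS : ∀ P ∈ S, P.rep ⬝ᵥ a ≠ 0 := by
    intro P hP
    rw [← eval_lin]
    exact Finset.prod_ne_zero_iff.1 (right_ne_zero_of_mul ha') P hP
  obtain ⟨b, hb⟩ := ex_cross ha0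
  set v := crossProduct a b with hv
  set w := crossProduct a v with hw
  have hav : a ⬝ᵥ v = 0 := dot_self_cross _ _
  have haw : a ⬝ᵥ w = 0 := dot_self_cross _ _
  have hvw : v ⬝ᵥ w = 0 := dot_cross_self _ _
  have hw0 : w ≠ 0 := by
    rw [hw, crossProduct_ne_zero_iff_linearIndependent, LinearIndependent.pair_iff' ha0]
    intro c hc
    rw [← hc, dotProduct_smul, smul_eq_mul] at hav
    have haa : a ⬝ᵥ a ≠ 0 := by rwa [Ne, dotProduct_self_eq_zero]
    have : c = 0 := (mul_eq_zero.1 hav).resolve_right haa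
    apply hb
    rw [← hc, this, zero_smul]
  let γ : ℝ → Fin 3 → ℝ := fun θ => Real.cos θ • v + Real.sin θ • w
  have hγc : Continuous γ := by fun_prop
  have hγ0 : ∀ θ, γ θ ≠ 0 := by
    intro θ h0
    have h1 : v ⬝ᵥ γ θ = 0 := by rw [h0, dotProduct_zero]
    have h2 : w ⬝ᵥ γ θ = 0 := by rw [h0, dotProduct_zero]
    simp only [γ, dotProduct_add, dotProduct_smul, smul_eq_mul, hvw, mul_zero, add_zero] at h1
    simp only [γ, dotProduct_add, dotProduct_smul, smul_eq_mul, dotProduct_comm w v, hvw, mul_zero,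
      zero_add] at h2
    have hvv : v ⬝ᵥ v ≠ 0 := by rwa [Ne, dotProduct_self_eq_zero]
    have hww : w ⬝ᵥ w ≠ 0 := by rwa [Ne, dotProduct_self_eq_zero]
    have c0 := (mul_eq_zero.1 h1).resolve_right hvv
    have s0 := (mul_eq_zero.1 h2).resolve_right hww
    have := Real.sin_sq_add_cos_sq θ
    rw [c0, s0] at this
    norm_num at this
  have hperp : ∀ θ, a ⬝ᵥ γ θ = 0 := by
    intro θ
    simp [γ, dotProduct_add, dotProduct_smul, hav, haw]
  have hφc : Continuous fun θ => eval (γ θ) f := (cont_eval f).comp hγc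
  have hπ : eval (γ Real.pi) f = - eval (γ 0) f := by
    have : γ Real.pi = (-1 : ℝ) • γ 0 := by simp [γ]
    rw [this, eval_smul_hom hf]; ring
  obtain ⟨θ, hθ⟩ : ∃ θ, eval (γ θ) f = 0 := by
    rcases le_total 0 (eval (γ 0) f) with h0 | h0
    · exact mem_range_of_exists_le_of_exists_ge hφc ⟨Real.pi, by rw [hπ]; linarith⟩ ⟨0, h0⟩
    · exact mem_range_of_exists_le_of_exists_ge hφc ⟨0, h0⟩ ⟨Real.pi, by rw [hπ]; linarith⟩
  refine ⟨Projectivization.mk ℝ (γ θ) (hγ0 θ), ?_, vanish_mk hf (hγ0 θ) hθ⟩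
  intro hmem
  apply haS _ hmem
  obtain ⟨c, hc⟩ := Projectivization.exists_smul_eq_mk_rep ℝ _ (hγ0 θ)
  have hc' : (c : ℝ) • γ θ = (Projectivization.mk ℝ _ (hγ0 θ)).rep := hc
  rw [← hc', smul_dotProduct, dotProduct_comm, hperp, smul_zero]

lemma exists_cubic (S : Finset P2) (hS : S.card = 9) :
    ∃ f : Pol, f.IsHomogeneous 3 ∧ f ≠ 0 ∧ ∀ P ∈ S, VanishAt f P := by
  let ev : Hm 3 →ₗ[ℝ] (S → ℝ) :=
    { toFun := fun F P => eval P.1.rep F.1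
      map_add' := fun F G => by ext P; simp
      map_smul' := fun c F => by ext P; simp [smul_eval] }
  have hlt : Module.finrank ℝ (S → ℝ) < Module.finrank ℝ (Hm 3) := by
    rw [finrank_Hm, Module.finrank_fintype_fun_eq_card, Fintype.card_coe, hS]
    decide
  have hk := LinearMap.ker_ne_bot_of_finrank_lt (f := ev) hlt
  obtain ⟨F, hF, hF0⟩ := (Submodule.ne_bot_iff _).1 hk
  refine ⟨F.1, F.2, fun h => hF0 (Subtype.ext h), fun P hP => ?_⟩
  have := congrFun (LinearMap.mem_ker.1 hF) ⟨P, hP⟩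
  exact this

lemma sub_smul_sing {h g : Pol} {S : Finset P2} (hh : ∀ P ∈ S, SingAt h P)
    (hg : ∀ P ∈ S, SingAt g P) (c : ℝ) : ∀ P ∈ S, SingAt (h - C c * g) P := by
  intro P hP
  obtain ⟨a1, a2⟩ := hh P hP
  obtain ⟨b1, b2⟩ := hg P hP
  refine ⟨by simp [a1, b1], fun i => ?_⟩
  simp [a2 i, b2 i]

lemma sing_mul {f k : Pol} {S : Finset P2} (hf : ∀ P ∈ S, VanishAt f P)
    (hk : ∀ P ∈ S, VanishAt k P) : ∀ P ∈ S, SingAt (f * k) P := by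
  intro P hP
  have a1 : eval P.rep f = 0 := hf P hP
  have b1 : eval P.rep k = 0 := hk P hP
  refine ⟨by simp [a1], fun i => ?_⟩
  simp [a1, b1]

/-- a multiple `r` of `f` in degree 3 is a scalar multiple -/
lemma scalar_of_dvd {f k : Pol} (hf : f.IsHomogeneous 3) (hk : k.IsHomogeneous 3) (hd : f ∣ k) :
    ∃ r : ℝ, k = C r * f := by
  by_cases hk0 : k = 0
  · exact ⟨0, by simp [hk0]⟩
  obtain ⟨m, rfl⟩ := hd
  obtain ⟨a, b, h1, h2, h3⟩ := hom_factor hk hk0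
  have := h1.inj_right hf (left_ne_zero_of_mul hk0)
  obtain rfl : b = 0 := by omega
  obtain ⟨r, rfl⟩ := hom0_C h2
  exact ⟨r, mul_comm _ _⟩

section
variable {g : Pol} {S : Finset P2} {f : Pol} {P : P2}

lemma g_ne (h : Setup g S) (hf : f.IsHomogeneous 3)
    (hf0 : f ≠ 0) (hfS : ∀ P ∈ S, VanishAt f P) (hP : P ∉ S) (hfP : VanishAt f P) :
    0 < eval P.rep g := by
  refine lt_of_le_of_ne (h.psd _) fun h0 => ?_
  have := (bezout2 hf h.hom hf0 (relprime_fg h hf hf0 hfS) S hfS h.sing).2.1 P hP hfP h0.symm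
  rw [h.card] at this
  omega

/-- every element of `I₆(2S)` is `c g + f k` with `k` a cubic through `S` -/
lemma decomp (h : Setup g S) (hf : f.IsHomogeneous 3)
    (hf0 : f ≠ 0) (hfS : ∀ P ∈ S, VanishAt f P) (hP : P ∉ S) (hfP : VanishAt f P)
    {q : Pol} (hq : q.IsHomogeneous 6) (hqS : ∀ P ∈ S, SingAt q P) :
    ∃ k : Pol, k.IsHomogeneous 3 ∧ (∀ P ∈ S, VanishAt k P) ∧
      q = C (eval P.rep q / eval P.rep g) * g + f * k := by
  have hgP := g_ne h hf hf0 hfS hP hfP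
  set c := eval P.rep q / eval P.rep g with hc
  have hq'S := sub_smul_sing hqS h.sing c
  have hq' : (q - C c * g).IsHomogeneous 6 := hq.sub (h.hom.C_mul c)
  have hz : VanishAt (q - C c * g) P := by
    unfold VanishAt
    rw [map_sub, map_mul, eval_C, hc]
    field_simp
    ring
  obtain ⟨k, hk⟩ := dvd2 h hf hf0 hfS hq' hq'S hP hfP hz
  refine ⟨k, ?_, ?_, by rw [← hk]; ring⟩
  · by_cases h0 : f * k = 0
    · rw [(mul_eq_zero.1 h0).resolve_left hf0]
      exact isHomogeneous_zero _ _ _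
    · rw [hk] at hq'
      obtain ⟨a, b, h1, h2, h3⟩ := hom_factor hq' h0
      have := h1.inj_right hf hf0
      obtain rfl : b = 3 := by omega
      exact h2
  · intro Q hQ
    have hsm : ¬ SingAt f Q := by
      intro hs
      have := (bezout2 hf h.hom hf0 (relprime_fg h hf hf0 hfS) S hfS h.sing).2.2 Q hQ hs
      rw [h.card] at this
      omega
    have hfQ : eval Q.rep f = 0 := hfS Q hQ
    unfold VanishAt
    by_contra hkQ
    apply hsm
    refine ⟨hfQ, fun i => ?_⟩
    have h1 := (hq'S Q hQ).2 i
    rw [hk] at h1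
    have h5 := congrFun (grad_mul f k Q.rep) i
    simp only [grad, Pi.add_apply, Pi.smul_apply, smul_eq_mul] at h5
    rw [h1, hfQ, zero_mul, zero_add] at h5
    exact (mul_eq_zero.1 h5.symm).resolve_left hkQ

lemma unique_cubic (h : Setup g S) (hf : f.IsHomogeneous 3)
    (hf0 : f ≠ 0) (hfS : ∀ P ∈ S, VanishAt f P) (hP : P ∉ S) (hfP : VanishAt f P)
    {k : Pol} (hk : k.IsHomogeneous 3) (hkS : ∀ P ∈ S, VanishAt k P) : f ∣ k := by
  by_contra hnd
  have hgP := g_ne h hf hf0 hfS hP hfP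
  have hkP : eval P.rep k ≠ 0 := fun h0 => hnd (dvd1 h hf hf0 hfS hk hkS hP hfP h0)
  obtain ⟨k', hk', hk'S, he⟩ := decomp h hf hf0 hfS hP hfP (hk.mul hk) (sing_mul hkS hkS)
  set c := eval P.rep (k * k) / eval P.rep g with hc
  have hcpos : 0 < c := by
    rw [hc, map_mul]
    have : 0 < eval P.rep k * eval P.rep k := mul_self_pos.2 hkP
    positivity
  set d := eval P.rep k' / eval P.rep k with hd
  obtain ⟨r, hr⟩ := scalar_of_dvd hf (hk'.sub (hk.C_mul d))
    (dvd1 h hf hf0 hfS (hk'.sub (hk.C_mul d)) (fun Q hQ => by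
      have a1 : eval Q.rep k = 0 := hkS Q hQ
      have a2 : eval Q.rep k' = 0 := hk'S Q hQ
      unfold VanishAt
      simp [a1, a2]) hP hfP (by
      unfold VanishAt
      rw [map_sub, map_mul, eval_C, hd]
      field_simp
      ring))
  -- c g = (k - d/2 f)^2 + (-r - d^2/4) f^2
  have hk'e : k' = C d * k + C r * f := by rw [← hr]; ring
  have hcg : ∀ u, c * eval u g = (eval u k - d / 2 * eval u f) ^ 2
      + (-r - d ^ 2 / 4) * (eval u f) ^ 2 := by
    intro u
    have h1 := congrArg (eval u) he
    rw [hk'e] at h1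
    simp only [map_mul, map_add, eval_C] at h1
    linear_combination -h1
  have hF : (k - C (d / 2) * f).IsHomogeneous 3 := hk.sub (hf.C_mul _)
  obtain ⟨Q, hQ, hFQ⟩ := extra_zero hF S
  have hFQ' : eval Q.rep k - d / 2 * eval Q.rep f = 0 := by
    have : eval Q.rep (k - C (d / 2) * f) = 0 := hFQ
    simpa using this
  have hfQ : eval Q.rep f ≠ 0 := by
    intro h0
    rw [h0, mul_zero, sub_zero] at hFQ'
    exact hnd (dvd1 h hf hf0 hfS hk hkS hQ h0 hFQ')
  have hnn : 0 ≤ -r - d ^ 2 / 4 := by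
    have h1 := hcg Q.rep
    rw [hFQ'] at h1
    have h2 := mul_nonneg hcpos.le (h.psd Q.rep)
    have h3 : 0 < (eval Q.rep f) ^ 2 := by positivity
    refine nonneg_of_mul_nonneg_left (b := (eval Q.rep f) ^ 2) ?_ h3
    linarith
  apply h.nsos
  refine ⟨2, ![C (Real.sqrt (1 / c)) * (k - C (d / 2) * f),
    C (Real.sqrt ((-r - d ^ 2 / 4) / c)) * f], ?_⟩
  apply MvPolynomial.funext
  intro u
  have h1 := hcg u
  rw [Fin.sum_univ_two]
  simp only [Matrix.cons_val_zero, Matrix.cons_val_one, map_add, map_mul, map_pow, map_sub, eval_C,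
    mul_pow]
  rw [Real.sq_sqrt (by positivity), Real.sq_sqrt (by positivity)]
  field_simp
  linarith

end

lemma main_fin {g : Pol} {S : Finset P2} (h : Setup g S) :
    Module.finrank ℝ (Isub2 6 (S : Set P2)) = 2 := by
  obtain ⟨f, hf, hf0, hfS⟩ := exists_cubic S h.card
  obtain ⟨P, hP, hfP⟩ := extra_zero hf S
  have hgP := g_ne h hf hf0 hfS hP hfP
  have hfP' : eval P.rep f = 0 := hfP
  have hli : LinearIndependent ℝ ![f * f, g] := by
    rw [LinearIndependent.pair_iff]
    intro s t hst
    have h1 := congrArg (eval P.rep) hst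
    simp only [map_add, smul_eval, map_mul, hfP', map_zero] at h1
    have ht : t = 0 := by
      have : t * eval P.rep g = 0 := by linarith
      exact (mul_eq_zero.1 this).resolve_right hgP.ne'
    subst ht
    rw [zero_smul, add_zero, smul_eq_zero] at hst
    exact ⟨hst.resolve_right (mul_ne_zero hf0 hf0), rfl⟩
  have hspan : Isub2 6 (S : Set P2) = Submodule.span ℝ (Set.range ![f * f, g]) := by
    apply le_antisymm
    · intro q hq
      obtain ⟨hq1, hq2⟩ := hq
      obtain ⟨k, hk, hkS, he⟩ := decomp h hf hf0 hfS hP hfP (q := q) hq1 (fun P hP => hq2 P hP)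
      obtain ⟨r, hr⟩ := scalar_of_dvd hf hk (unique_cubic h hf hf0 hfS hP hfP hk hkS)
      have he2 : q = r • (f * f) + (eval P.rep q / eval P.rep g) • g := by
        rw [smul_eq_C_mul, smul_eq_C_mul]
        rw [hr] at he
        linear_combination he
      rw [he2]
      exact Submodule.add_mem _
        (Submodule.smul_mem _ _ (Submodule.subset_span ⟨0, rfl⟩))
        (Submodule.smul_mem _ _ (Submodule.subset_span ⟨1, rfl⟩))
    · rw [Submodule.span_le]
      rintro _ ⟨i, rfl⟩
      fin_cases i
      · exact ⟨hf.mul hf, fun P hP => sing_mul hfS hfS P hP⟩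
      · exact ⟨h.hom, fun P hP => h.sing P hP⟩
  rw [hspan, finrank_span_eq_card hli]
  simp

theorem statement10 (S : Set P2) (hS9 : S.encard = 9)
    (hex : ∃ g : MvPolynomial (Fin 3) ℝ, g.IsHomogeneous 6 ∧ Psd g ∧
      (∀ P ∈ S, VanishAt g P) ∧ ¬ Sos g) :
    Module.finrank ℝ (Isub2 6 S) = 2 := by
  obtain ⟨g, h1, h2, h3, h4⟩ := hex
  have hfin : S.Finite := Set.finite_of_encard_eq_coe hS9
  obtain ⟨T, rfl⟩ := hfin.exists_finset_coe
  rw [Set.encard_coe_eq_coe_finsetCard] at hS9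
  exact main_fin ⟨h1, h2, h4, fun P hP => h3 P hP, by exact_mod_cast hS9⟩

end
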